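/- Assume MSCD. Let t₁,…,t_m ∈ ℍ be a convenient tuple for j and set F := ℚ(t, J(t)). Then for all z₁,…,zₙ ∈ ℍ: tr.deg_F F(z, J(z)) ≥ 3·dim_G(z|Σ ∪ t) + dim^j(z|t), and tr.deg_F F(z, j(z)) ≥ dim_G(z|Σ ∪ t) + dim^j(z|t). -/

import Mathlib

noncomputable section

namespace ModularJPaper

/-! ### Basic objects: the upper half-plane, Möbius actions, the modular `j`-function -/

/-- The complex upper half-plane, as a subset of `ℂ`. -/
def HH : Set ℂ := {z : ℂ | 0 < z.im}

/-- The Möbius action of a complex 2×2 matrix on `ℂ`. -/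
def moeb (g : Matrix (Fin 2) (Fin 2) ℂ) (z : ℂ) : ℂ :=
  (g 0 0 * z + g 0 1) / (g 1 0 * z + g 1 1)

/-- A rational 2×2 matrix viewed as a complex one. -/
def qmat (g : Matrix (Fin 2) (Fin 2) ℚ) : Matrix (Fin 2) (Fin 2) ℂ :=
  g.map (fun a => (a : ℂ))

/-- An integer 2×2 matrix viewed as a complex one. -/
def zmat (g : Matrix (Fin 2) (Fin 2) ℤ) : Matrix (Fin 2) (Fin 2) ℂ :=
  g.map (fun a => (a : ℂ))

/-- `IsModularJ j` says that `j : ℂ → ℂ` restricts on the upper half-plane to *the*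
modular `j`-function: it is holomorphic on `ℍ`, invariant under `SL₂(ℤ)`, and has a
Fourier expansion `j(z) = q⁻¹ + 744 + ∑_{k ≥ 1} a_k q^k` with `q = exp(2πiz)`.
(These properties determine `j` uniquely on `ℍ`.) -/
structure IsModularJ (j : ℂ → ℂ) : Prop where
  holo : DifferentiableOn ℂ j HH
  invariant : ∀ g : Matrix (Fin 2) (Fin 2) ℤ, g.det = 1 → ∀ z ∈ HH, j (moeb (zmat g) z) = j z
  fourier : ∃ a : ℕ → ℂ, ∀ z ∈ HH,
    HasSum (fun k : ℕ => a k * Complex.exp (2 * (Real.pi : ℂ) * Complex.I * z) ^ (k + 1))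
      (j z - (Complex.exp (2 * (Real.pi : ℂ) * Complex.I * z))⁻¹ - 744)

/-! ### Algebraic sets, Zariski closure, irreducibility, dimension -/

/-- `V` is an algebraic subset of `ℂ^ι` (the common zero set of a family of polynomials). -/
def IsAlgSet {ι : Type*} (V : Set (ι → ℂ)) : Prop :=
  ∃ P : Set (MvPolynomial ι ℂ), V = {x | ∀ p ∈ P, MvPolynomial.eval x p = 0}

/-- `V` is an algebraic subset of `ℂ^ι` defined by polynomials with coefficients in `L`. -/
def IsAlgSetOver {ι : Type*} (L : Set ℂ) (V : Set (ι → ℂ)) : Prop :=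
  ∃ P : Set (MvPolynomial ι ℂ),
    (∀ p ∈ P, ∀ m : ι →₀ ℕ, MvPolynomial.coeff m p ∈ L) ∧
    V = {x | ∀ p ∈ P, MvPolynomial.eval x p = 0}

/-- The Zariski closure of a subset of `ℂ^ι`. -/
def zcl {ι : Type*} (S : Set (ι → ℂ)) : Set (ι → ℂ) :=
  ⋂₀ {T | IsAlgSet T ∧ S ⊆ T}

/-- Irreducibility (in the Zariski topology) of a subset of `ℂ^ι`. -/
def IsIrr {ι : Type*} (S : Set (ι → ℂ)) : Prop :=
  S.Nonempty ∧ ∀ V W : Set (ι → ℂ), IsAlgSet V → IsAlgSet W → S ⊆ V ∪ W → S ⊆ V ∨ S ⊆ W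

/-- The dimension of (the Zariski closure of) a subset of `ℂ^ι`: the supremum of the
lengths of strictly increasing chains of irreducible algebraic subsets of its closure. -/
def adim {ι : Type*} (S : Set (ι → ℂ)) : ℕ :=
  sSup {k : ℕ | ∃ c : Fin (k + 1) → Set (ι → ℂ), StrictMono c ∧
    ∀ i, IsAlgSet (c i) ∧ IsIrr (c i) ∧ c i ⊆ zcl S}

/-- `X` is an irreducible component of (the Zariski closure of) the set `A`. -/
def IsIrrCompOf {ι : Type*} (X A : Set (ι → ℂ)) : Prop :=
  IsAlgSet X ∧ IsIrr X ∧ X ⊆ zcl A ∧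
    ∀ Y : Set (ι → ℂ), IsAlgSet Y → IsIrr Y → Y ⊆ zcl A → X ⊆ Y → X = Y

/-- Constructible subsets of `ℂ^ι`: finite unions of differences of algebraic sets. -/
def IsConstr {ι : Type*} (S : Set (ι → ℂ)) : Prop :=
  ∃ (k : ℕ) (A B : Fin k → Set (ι → ℂ)),
    (∀ i, IsAlgSet (A i) ∧ IsAlgSet (B i)) ∧ S = ⋃ i, A i \ B i

/-- No coordinate is constant on `V`. -/
def NoConstCoord {ι : Type*} (V : Set (ι → ℂ)) : Prop :=
  ∀ (i : ι) (c : ℂ), ∃ v ∈ V, v i ≠ c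

/-- The fibre of a parametric family `F ⊆ ℂ^ι × ℂ^κ` over the parameter `q`. -/
def fib {ι κ : Type*} (F : Set ((ι ⊕ κ) → ℂ)) (q : κ → ℂ) : Set (ι → ℂ) :=
  {s | Sum.elim s q ∈ F}

/-! ### Transcendence degree and finitely generated subfields of `ℂ` -/

/-- The transcendence degree `tr.deg_K K(v)` of the field generated over `K` by the
coordinates of the tuple `v`: the maximal size of a subfamily of `v` that is
algebraically independent over `K`. -/
def trdegF (K : Subfield ℂ) {ι : Type*} (v : ι → ℂ) : ℕ :=
  sSup {k : ℕ | ∃ t : Finset ι, t.card = k ∧ AlgebraicIndependent K (fun i : t => v i.1)}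

/-- `K` is a finitely generated subfield of `ℂ`. -/
def FGField (K : Subfield ℂ) : Prop :=
  ∃ s : Finset ℂ, K = Subfield.closure ↑s

/-! ### The set Σ of quadratic points, `GL₂⁺(ℚ)`-orbits, special points -/

/-- `Σ`: the quadratic points of the upper half-plane. -/
def SigmaSet : Set ℂ := {z | z ∈ HH ∧ (minpoly ℚ z).natDegree = 2}

/-- `x` and `y` are related by the Möbius action of an element of `G = GL₂⁺(ℚ)`. -/
def GRel (x y : ℂ) : Prop :=
  ∃ g : Matrix (Fin 2) (Fin 2) ℚ, 0 < g.det ∧ moeb (qmat g) x = y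

/-- The `GL₂⁺(ℚ)`-orbit of `x`. -/
def Gorb (x : ℂ) : Set ℂ := {y | GRel x y}

/-- `dim_G(z | C)`: the number of distinct `G`-orbits of coordinates of the tuple `z`
which contain no element of `C`. -/
def dimG {ι : Type*} (z : ι → ℂ) (C : Set ℂ) : ℕ :=
  Set.ncard {S : Set ℂ | ∃ i : ι, S = Gorb (z i) ∧ ∀ c ∈ C, ¬ GRel (z i) c}

/-- `w` is a special point (singular modulus): `w = j(τ)` for a quadratic `τ ∈ ℍ`. -/
def IsSpecialPt (j : ℂ → ℂ) (w : ℂ) : Prop := ∃ τ ∈ SigmaSet, w = j τ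

/-- The zero set of the modular polynomial `Φ_N`, described via the modular
correspondence: `Φ_N(x,y) = 0` iff `x = j(z)` and `y = j(gz)` for some `z ∈ ℍ` and
some primitive integer matrix `g` of determinant `N`. -/
def PhiRel (j : ℂ → ℂ) (N : ℕ) (x y : ℂ) : Prop :=
  ∃ z ∈ HH, ∃ g : Matrix (Fin 2) (Fin 2) ℤ, g.det = (N : ℤ) ∧
    Nat.gcd (Int.gcd (g 0 0) (g 0 1)) (Int.gcd (g 1 0) (g 1 1)) = 1 ∧
    x = j z ∧ y = j (moeb (zmat g) z)

/-! ### Special, weakly special and Möbius subvarieties -/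

/-- An algebraic set cut out by modular relations `Φ_N(Y_i, Y_k) = 0` and by equations
`Y_i = τ` with `τ` a special point. -/
def IsSpecialBase {ι : Type*} (j : ℂ → ℂ) (B : Set (ι → ℂ)) : Prop :=
  ∃ (R : Set (ι × ι × ℕ)) (E : Set (ι × ℂ)),
    (∀ r ∈ R, 1 ≤ r.2.2) ∧ (∀ e ∈ E, IsSpecialPt j e.2) ∧
    B = {y | (∀ r ∈ R, PhiRel j r.2.2 (y r.1) (y r.2.1)) ∧ ∀ e ∈ E, y e.1 = e.2}

/-- A special subvariety of `Y(1)^ι`: an irreducible component of an algebraic set cut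
out by modular relations and special-point constant equations. -/
def IsSpecial {ι : Type*} (j : ℂ → ℂ) (T : Set (ι → ℂ)) : Prop :=
  ∃ B, IsSpecialBase j B ∧ IsIrrCompOf T B

/-- A weakly special subvariety of `Y(1)^ι`: an irreducible component of an algebraic
set cut out by modular relations and arbitrary constant equations. -/
def IsWSpecial {ι : Type*} (j : ℂ → ℂ) (T : Set (ι → ℂ)) : Prop :=
  ∃ (R : Set (ι × ι × ℕ)) (E : Set (ι × ℂ)), (∀ r ∈ R, 1 ≤ r.2.2) ∧
    IsIrrCompOf T {y | (∀ r ∈ R, PhiRel j r.2.2 (y r.1) (y r.2.1)) ∧ ∀ e ∈ E, y e.1 = e.2}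

/-- A weakly special subvariety of complexity at most `N`: only modular polynomials
`Φ_M` with `M ≤ N` are needed to define it. -/
def IsWSpecialLE {ι : Type*} (j : ℂ → ℂ) (N : ℕ) (T : Set (ι → ℂ)) : Prop :=
  ∃ (R : Set (ι × ι × ℕ)) (E : Set (ι × ℂ)), (∀ r ∈ R, 1 ≤ r.2.2 ∧ r.2.2 ≤ N) ∧
    IsIrrCompOf T {y | (∀ r ∈ R, PhiRel j r.2.2 (y r.1) (y r.2.1)) ∧ ∀ e ∈ E, y e.1 = e.2}

/-- A basic special subvariety: a special subvariety with no constant coordinates. -/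
def IsBasicSpecial {ι : Type*} (j : ℂ → ℂ) (T : Set (ι → ℂ)) : Prop :=
  IsSpecial j T ∧ NoConstCoord T

/-- The special closure of `X`: the smallest special subvariety containing `X`. -/
def spcl {ι : Type*} (j : ℂ → ℂ) (X : Set (ι → ℂ)) : Set (ι → ℂ) :=
  ⋂₀ {T | IsSpecial j T ∧ X ⊆ T}

/-- The weakly special closure of `X`. -/
def wspcl {ι : Type*} (j : ℂ → ℂ) (X : Set (ι → ℂ)) : Set (ι → ℂ) :=
  ⋂₀ {T | IsWSpecial j T ∧ X ⊆ T}

/-- The Möbius relation `M_g(x,y) = y(cx+d) - (ax+b) = 0` attached to a 2×2 matrix. -/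
def MrelC (g : Matrix (Fin 2) (Fin 2) ℂ) (x y : ℂ) : Prop :=
  y * (g 1 0 * x + g 1 1) - (g 0 0 * x + g 0 1) = 0

/-- A 2×2 matrix is non-scalar. -/
def NonScalar (g : Matrix (Fin 2) (Fin 2) ℂ) : Prop :=
  ¬ (g 0 1 = 0 ∧ g 1 0 = 0 ∧ g 0 0 = g 1 1)

/-- A Möbius subvariety of `ℂ^ι`: cut out by finitely many relations `M_g(X_i, X_k) = 0`
with `g` non-scalar in `GL₂(ℂ)`. -/
def IsMoebius {ι : Type*} (M : Set (ι → ℂ)) : Prop :=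
  ∃ (D : Finset (ι × ι)) (f : ι × ι → Matrix (Fin 2) (Fin 2) ℂ),
    (∀ p ∈ D, (f p).det ≠ 0 ∧ NonScalar (f p)) ∧
    M = {x | ∀ p ∈ D, MrelC (f p) (x p.1) (x p.2)}

/-- A Möbius subvariety of `ℂ^ι` defined by matrices in `G = GL₂⁺(ℚ)`. -/
def IsMoebiusQpos {ι : Type*} (M : Set (ι → ℂ)) : Prop :=
  ∃ (D : Finset (ι × ι)) (f : ι × ι → Matrix (Fin 2) (Fin 2) ℚ),
    (∀ p ∈ D, 0 < (f p).det ∧ NonScalar (qmat (f p))) ∧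
    M = {x | ∀ p ∈ D, MrelC (qmat (f p)) (x p.1) (x p.2)}

/-- A Möbius subvariety of `ℂ^ι` defined over `ℚ` (rational invertible non-scalar
matrices). -/
def IsMoebiusRat {ι : Type*} (M : Set (ι → ℂ)) : Prop :=
  ∃ (D : Finset (ι × ι)) (f : ι × ι → Matrix (Fin 2) (Fin 2) ℚ),
    (∀ p ∈ D, (f p).det ≠ 0 ∧ NonScalar (qmat (f p))) ∧
    M = {x | ∀ p ∈ D, MrelC (qmat (f p)) (x p.1) (x p.2)}

/-! ### The two-sorted space `ℂⁿ × Y(1)ⁿ`, broadness, freeness, (EC) -/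

/-- The coordinate projection `Pr_i : ℂⁿ × Y(1)ⁿ → ℂ^ℓ × Y(1)^ℓ` attached to a tuple
`i₁ < ⋯ < i_ℓ`. -/
def prSum {n ℓ : ℕ} (i : Fin ℓ → Fin n) (v : (Fin n ⊕ Fin n) → ℂ) : (Fin ℓ ⊕ Fin ℓ) → ℂ :=
  Sum.elim (fun k => v (Sum.inl (i k))) (fun k => v (Sum.inr (i k)))

/-- `V ⊆ ℂⁿ × Y(1)ⁿ` is broad: `dim Pr_i(V) ≥ ℓ` for every tuple `i₁ < ⋯ < i_ℓ`. -/
def Broad {n : ℕ} (V : Set ((Fin n ⊕ Fin n) → ℂ)) : Prop :=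
  ∀ (ℓ : ℕ) (i : Fin ℓ → Fin n), 1 ≤ ℓ → StrictMono i → ℓ ≤ adim (prSum i '' V)

/-- `V ⊆ ℂⁿ × Y(1)ⁿ` is modularly free: `V` is not contained in `ℂⁿ × T` for any proper
special subvariety `T` of `Y(1)ⁿ`. -/
def ModularlyFree {n : ℕ} (j : ℂ → ℂ) (V : Set ((Fin n ⊕ Fin n) → ℂ)) : Prop :=
  ∀ T : Set (Fin n → ℂ), IsSpecial j T → T ≠ Set.univ →
    ¬ V ⊆ {v | (fun k => v (Sum.inr k)) ∈ T}

/-- `V ⊆ ℂⁿ × Y(1)ⁿ` is free. -/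
def Free {n : ℕ} (j : ℂ → ℂ) (V : Set ((Fin n ⊕ Fin n) → ℂ)) : Prop :=
  NoConstCoord V ∧
  (∀ M : Set (Fin n → ℂ), IsMoebiusQpos M → M ≠ Set.univ →
    ¬ V ⊆ {v | (fun k => v (Sum.inl k)) ∈ M}) ∧
  ModularlyFree j V

/-- The graph `E_jⁿ ⊆ ℂⁿ × Y(1)ⁿ` of the `j`-function. -/
def Ej (j : ℂ → ℂ) (n : ℕ) : Set ((Fin n ⊕ Fin n) → ℂ) :=
  {v | (∀ k, v (Sum.inl k) ∈ HH) ∧ ∀ k, v (Sum.inr k) = j (v (Sum.inl k))}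

/-- `V` satisfies (EC): `V ∩ E_jⁿ` is Zariski dense in `V`. -/
def SatisfiesEC {n : ℕ} (j : ℂ → ℂ) (V : Set ((Fin n ⊕ Fin n) → ℂ)) : Prop :=
  V ⊆ zcl (V ∩ Ej j n)

/-! ### MSCD and MZP -/

/-- The modular Schanuel conjecture with derivatives. -/
def MSCD (j : ℂ → ℂ) : Prop :=
  ∀ (n : ℕ) (z : Fin n → ℂ), (∀ i, z i ∈ HH) →
    3 * dimG z SigmaSet ≤
      trdegF ⊥ (fun p : Fin 4 × Fin n =>
        ![z, j ∘ z, deriv j ∘ z, deriv (deriv j) ∘ z] p.1 p.2)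

/-- `X` is an atypical component of `W ⊆ Y(1)ⁿ`: an irreducible component of `W ∩ T`,
for some special subvariety `T`, with `dim X > dim W + dim T − n`. -/
def IsAtypComp {n : ℕ} (j : ℂ → ℂ) (W X : Set (Fin n → ℂ)) : Prop :=
  ∃ T, IsSpecial j T ∧ IsIrrCompOf X (W ∩ T) ∧
    (adim W : ℤ) + (adim T : ℤ) - (n : ℤ) < (adim X : ℤ)

/-- The modular Zilber–Pink conjecture: every subvariety of `Y(1)ⁿ` has finitely many
maximal atypical components. -/
def MZP (j : ℂ → ℂ) : Prop :=
  ∀ (n : ℕ) (W : Set (Fin n → ℂ)), IsAlgSet W →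
    {X | IsAtypComp j W X ∧ ∀ X', IsAtypComp j W X' → X ⊆ X' → X = X'}.Finite

/-! ### `j`-derivations, `jcl`, `C_j`, `dim^j` -/

/-- A `j`-derivation on `ℂ`. -/
def IsJDeriv (j : ℂ → ℂ) (D : ℂ → ℂ) : Prop :=
  (∀ a b : ℂ, D (a + b) = D a + D b) ∧
  (∀ a b : ℂ, D (a * b) = a * D b + b * D a) ∧
  (∀ z ∈ HH, ∀ k : ℕ, D (deriv^[k] j z) = deriv^[k + 1] j z * D z)

/-- The `j`-closure of a subset of `ℂ`. -/
def jcl (j : ℂ → ℂ) (A : Set ℂ) : Set ℂ :=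
  {x | ∀ D : ℂ → ℂ, IsJDeriv j D → (∀ a ∈ A, D a = 0) → D x = 0}

/-- `C_j = jcl(∅)`. -/
def Cj (j : ℂ → ℂ) : Set ℂ := jcl j ∅

/-- `dim^j(A|B) ≥ n`. -/
def dimjGE (j : ℂ → ℂ) (A B : Set ℂ) (n : ℕ) : Prop :=
  ∃ (a : Fin n → ℂ) (D : Fin n → ℂ → ℂ),
    (∀ i, a i ∈ jcl j A) ∧
    (∀ i, IsJDeriv j (D i) ∧ ∀ b ∈ B, D i b = 0) ∧
    (∀ i k, D i (a k) = if i = k then 1 else 0)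

/-- `dim^j(A|B)`, the relative dimension in the pregeometry `jcl`. -/
def dimj (j : ℂ → ℂ) (A B : Set ℂ) : ℕ := sSup {n | dimjGE j A B n}

/-- `V ⊆ ℂⁿ × Y(1)ⁿ` (broad) has no `C_j`-factors. -/
def NoCjFactors {n : ℕ} (j : ℂ → ℂ) (V : Set ((Fin n ⊕ Fin n) → ℂ)) : Prop :=
  ∀ (ℓ : ℕ) (i : Fin ℓ → Fin n), 1 ≤ ℓ → StrictMono i →
    ℓ < adim (prSum i '' V) ∨
    (adim (prSum i '' V) = ℓ ∧ ¬ IsAlgSetOver (Cj j) (zcl (prSum i '' V)))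

/-- A tuple `t ∈ ℍ^m` is convenient for `j`:
`tr.deg_ℚ ℚ(t, J(t)) = 3 dim_G(t|Σ) + dim^j(t)`. -/
def ConvenientTuple (j : ℂ → ℂ) {m : ℕ} (t : Fin m → ℂ) : Prop :=
  (∀ i, t i ∈ HH) ∧
  trdegF ⊥ (fun p : Fin 4 × Fin m =>
      ![t, j ∘ t, deriv j ∘ t, deriv (deriv j) ∘ t] p.1 p.2)
    = 3 * dimG t SigmaSet + dimj j (Set.range t) ∅

/-! ### Iterates of `j` -/

/-- The iterates of `j`: `jIt j 0 = id`, `jIt j (n+1) = j ∘ jIt j n`; so `j_n = jIt j n`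
for `n ≥ 1`. -/
def jIt (j : ℂ → ℂ) : ℕ → ℂ → ℂ
  | 0 => id
  | n + 1 => j ∘ jIt j n

/-- The domain `ℍ_n` of `j_n`: `ℍ₁ = ℍ`, `ℍ_{n+1} = {z ∈ ℍ_n : j_n(z) ∈ ℍ}`. -/
def HHn (j : ℂ → ℂ) : ℕ → Set ℂ
  | 0 => Set.univ
  | n + 1 => {z ∈ HHn j n | jIt j n z ∈ HH}

/-! ### The space `ℂⁿ × Y₂(1)ⁿ` with derivatives -/

/-- The projection `PR_i : ℂⁿ × Y₂(1)ⁿ → ℂ^ℓ × Y₂(1)^ℓ`. -/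
def prJ {n ℓ : ℕ} (i : Fin ℓ → Fin n) (v : (Fin n ⊕ Fin n × Fin 3) → ℂ) :
    (Fin ℓ ⊕ Fin ℓ × Fin 3) → ℂ :=
  Sum.elim (fun k => v (Sum.inl (i k))) (fun p => v (Sum.inr (i p.1, p.2)))

/-- `V ⊆ ℂⁿ × Y₂(1)ⁿ` is `J`-broad: `dim PR_i(V) ≥ 3ℓ` for all `i`. -/
def JBroad {n : ℕ} (V : Set ((Fin n ⊕ Fin n × Fin 3) → ℂ)) : Prop :=
  ∀ (ℓ : ℕ) (i : Fin ℓ → Fin n), 1 ≤ ℓ → StrictMono i → 3 * ℓ ≤ adim (prJ i '' V)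

/-- `V ⊆ ℂⁿ × Y₂(1)ⁿ` is `J`-free. -/
def JFree {n : ℕ} (j : ℂ → ℂ) (V : Set ((Fin n ⊕ Fin n × Fin 3) → ℂ)) : Prop :=
  NoConstCoord V ∧
  (∀ M : Set (Fin n → ℂ), IsMoebiusRat M → M ≠ Set.univ →
    ¬ V ⊆ {v | (fun k => v (Sum.inl k)) ∈ M}) ∧
  (∀ T : Set (Fin n → ℂ), IsSpecial j T → T ≠ Set.univ →
    ¬ V ⊆ {v | (fun k => v (Sum.inr (k, 0))) ∈ T})

/-- The graph `E_Jⁿ ⊆ ℂⁿ × Y₂(1)ⁿ` of `J = (j, j′, j″)`. -/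
def EJ (j : ℂ → ℂ) (n : ℕ) : Set ((Fin n ⊕ Fin n × Fin 3) → ℂ) :=
  {v | (∀ k, v (Sum.inl k) ∈ HH) ∧ ∀ k : Fin n,
      v (Sum.inr (k, 0)) = j (v (Sum.inl k)) ∧
      v (Sum.inr (k, 1)) = deriv j (v (Sum.inl k)) ∧
      v (Sum.inr (k, 2)) = deriv (deriv j) (v (Sum.inl k))}

/-- `V ⊆ ℂⁿ × Y₂(1)ⁿ` (J-broad) has no `C_j`-factors. -/
def NoCjFactorsJ {n : ℕ} (j : ℂ → ℂ) (V : Set ((Fin n ⊕ Fin n × Fin 3) → ℂ)) : Prop :=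
  ∀ (ℓ : ℕ) (i : Fin ℓ → Fin n), 1 ≤ ℓ → StrictMono i →
    3 * ℓ < adim (prJ i '' V) ∨
    (adim (prJ i '' V) = 3 * ℓ ∧ ¬ IsAlgSetOver (Cj j) (zcl (prJ i '' V)))

/-- The relative algebraic closure in `ℂ` of the field generated by `A` over `K`. -/
def acl (K : Subfield ℂ) (A : Set ℂ) : Subfield ℂ where
  __ := (Subalgebra.algebraicClosure (Algebra.adjoin K A) ℂ).toSubring
  inv_mem' _ h := IsAlgebraic.inv h

lemma mem_acl {K : Subfield ℂ} {A : Set ℂ} {x : ℂ} :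
    x ∈ acl K A ↔ IsAlgebraic (Algebra.adjoin K A) x := Iff.rfl

lemma subset_acl (K : Subfield ℂ) (A : Set ℂ) : A ⊆ acl K A := fun x hx =>
  isAlgebraic_algebraMap (A := ℂ) (⟨x, Algebra.subset_adjoin hx⟩ : Algebra.adjoin K A)

lemma isAlgebraic_of_subset {R S : Type*} [SetLike R ℂ] [SubringClass R ℂ] [SetLike S ℂ]
    [SubringClass S ℂ] {r : R} {s : S} (h : ∀ y ∈ r, y ∈ s) {x : ℂ} (hx : IsAlgebraic r x) :
    IsAlgebraic s x := by
  obtain ⟨p, hp0, hp⟩ := hx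
  let f : r →+* s := (SubringClass.subtype r).codRestrict s (fun y => h _ y.2)
  have hf : Function.Injective f := fun a b hab => Subtype.ext (congrArg (fun y : s => (y : ℂ)) hab)
  refine ⟨p.map f, (Polynomial.map_ne_zero_iff hf).2 hp0, ?_⟩
  rw [Polynomial.aeval_def, Polynomial.eval₂_map]
  exact hp

lemma field_le_acl (K : Subfield ℂ) (A : Set ℂ) : K ≤ acl K A := fun x hx =>
  isAlgebraic_algebraMap (A := ℂ) (algebraMap K (Algebra.adjoin K A) ⟨x, hx⟩)

lemma mem_acl_of_isAlgebraic {K : Subfield ℂ} {A : Set ℂ} {x : ℂ}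
    (hx : IsAlgebraic (acl K A) x) : x ∈ acl K A :=
  IsAlgebraic.restrictScalars (Algebra.adjoin K A)
    (S := Subalgebra.algebraicClosure (Algebra.adjoin K A) ℂ)
    (isAlgebraic_of_subset (fun _ h => h) hx)

lemma acl_le {K E : Subfield ℂ} {A : Set ℂ} (hE : ∀ x : ℂ, IsAlgebraic E x → x ∈ E)
    (hK : K ≤ E) (hA : A ⊆ E) : acl K A ≤ E := fun x hx => by
  refine hE x (isAlgebraic_of_subset (r := Algebra.adjoin K A) (fun y hy => ?_) hx)
  induction hy using Algebra.adjoin_induction with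
  | mem y hy => exact hA hy
  | algebraMap r => exact hK r.2
  | add _ _ _ _ h1 h2 => exact add_mem h1 h2
  | mul _ _ _ _ h1 h2 => exact mul_mem h1 h2

lemma acl_le_acl {K L : Subfield ℂ} {A B : Set ℂ} (hK : K ≤ acl L B) (hA : A ⊆ acl L B) :
    acl K A ≤ acl L B :=
  acl_le (fun _ => mem_acl_of_isAlgebraic) hK hA

lemma acl_mono (K : Subfield ℂ) {A B : Set ℂ} (h : A ⊆ B) : acl K A ≤ acl K B :=
  acl_le_acl (field_le_acl K B) (h.trans (subset_acl K B))

section trdeg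
variable {ι : Type*} {K : Subfield ℂ} {v : ι → ℂ}

lemma card_le_of_algebraicIndependent {t : Finset ι}
    (ht : AlgebraicIndependent K (fun i : t => v i.1)) {G : Finset ℂ}
    (hG : ∀ i ∈ t, v i ∈ acl K (G : Set ℂ)) : t.card ≤ G.card := by
  have hinj : Set.InjOn v (t : Set ι) := fun a ha b hb hab =>
    congrArg Subtype.val (ht.injective (a₁ := ⟨a, ha⟩) (a₂ := ⟨b, hb⟩) hab)
  have hind : (AlgebraicIndependent.matroid K ℂ).Indep (v '' t) := by
    rw [AlgebraicIndependent.matroid_indep_iff]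
    exact (algebraicIndependent_image hinj).1 ht
  have hsub : v '' t ⊆ (AlgebraicIndependent.matroid K ℂ).closure (G : Set ℂ) := by
    rw [AlgebraicIndependent.matroid_closure_eq]
    rintro _ ⟨i, hi, rfl⟩
    exact hG i hi
  have h := (hind.encard_le_eRk_of_subset hsub).trans
    ((Matroid.eRk_closure_eq _ _).trans_le (Matroid.eRk_le_encard _ _))
  rw [hinj.encard_image, Set.encard_coe_eq_coe_finsetCard, Set.encard_coe_eq_coe_finsetCard] at h
  exact_mod_cast h

lemma trdegF_le {G : Finset ℂ} (hG : ∀ i, v i ∈ acl K (G : Set ℂ)) : trdegF K v ≤ G.card :=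
  csSup_le' (by rintro _ ⟨t, rfl, ht⟩; exact card_le_of_algebraicIndependent ht fun i _ => hG i)

lemma card_le_trdegF [Fintype ι] {t : Finset ι}
    (ht : AlgebraicIndependent K (fun i : t => v i.1)) : t.card ≤ trdegF K v :=
  le_csSup ⟨Fintype.card ι, by rintro _ ⟨t, rfl, -⟩; exact t.card_le_univ⟩ ⟨t, rfl, ht⟩

lemma algebraicIndependent_insert [DecidableEq ι] {t : Finset ι}
    (ht : AlgebraicIndependent K (fun i : t => v i.1)) {i : ι}
    (hi : v i ∉ acl K (v '' (t : Set ι))) :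
    AlgebraicIndependent K (fun k : (insert i t : Finset ι) => v k.1) := by
  have h : AlgebraicIndepOn K v (insert i (t : Set ι)) :=
    AlgebraicIndepOn.insert (s := (t : Set ι)) ht hi
  rw [← Finset.coe_insert] at h
  exact h

lemma exists_algebraicIndependent_between {t₀ s : Finset ι}
    (ht₀ : AlgebraicIndependent K (fun i : t₀ => v i.1)) (hs : t₀ ⊆ s) :
    ∃ t, t₀ ⊆ t ∧ t ⊆ s ∧ AlgebraicIndependent K (fun i : t => v i.1) ∧
      ∀ i ∈ s, v i ∈ acl K (v '' (t : Set ι)) := by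
  classical
  let P := s.powerset.filter fun t => t₀ ⊆ t ∧ AlgebraicIndependent K (fun i : t => v i.1)
  have hP : P.Nonempty := ⟨t₀, by simp [P, hs, ht₀]⟩
  obtain ⟨t, htP, hmax⟩ := P.exists_max_image Finset.card hP
  simp only [P, Finset.mem_filter, Finset.mem_powerset] at htP hmax
  refine ⟨t, htP.2.1, htP.1, htP.2.2, fun i hi => ?_⟩
  by_contra hcon
  have hit : i ∉ t := fun hit => hcon (subset_acl _ _ ⟨i, hit, rfl⟩)
  have := hmax (insert i t) ⟨Finset.insert_subset hi htP.1,
    htP.2.1.trans (Finset.subset_insert _ _), algebraicIndependent_insert htP.2.2 hcon⟩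
  rw [Finset.card_insert_of_notMem hit] at this
  omega

lemma algebraicIndependent_empty_finset :
    AlgebraicIndependent K (fun i : (∅ : Finset ι) => v i.1) := by
  have : IsEmpty (∅ : Finset ι) := ⟨fun x => absurd x.2 (Finset.notMem_empty _)⟩
  rw [algebraicIndependent_empty_type_iff]
  exact (algebraMap K ℂ).injective

lemma exists_finset_card_le_trdegF [Fintype ι] :
    ∃ t : Finset ι, t.card ≤ trdegF K v ∧ ∀ i, v i ∈ acl K (v '' (t : Set ι)) := by
  obtain ⟨t, -, -, h1, h2⟩ := exists_algebraicIndependent_between (K := K) (v := v)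
    algebraicIndependent_empty_finset (Finset.empty_subset Finset.univ)
  exact ⟨t, card_le_trdegF h1, fun i => h2 i (Finset.mem_univ i)⟩

end trdeg

lemma rat_linear_eq_zero {x : ℂ} (hx : x ∈ HH) {a b : ℚ} (h : (a : ℂ) * x + b = 0) :
    a = 0 ∧ b = 0 := by
  have him := congrArg Complex.im h
  have ha : a = 0 := by
    have : (a : ℝ) * x.im = 0 := by simpa using him
    rcases mul_eq_zero.1 this with h1 | h1
    · exact_mod_cast h1
    · exact absurd h1 (ne_of_gt hx)
  subst ha
  exact ⟨rfl, by simpa using h⟩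

lemma moeb_denom_ne_zero {x : ℂ} (hx : x ∈ HH) {g : Matrix (Fin 2) (Fin 2) ℚ} (hg : 0 < g.det) :
    qmat g 1 0 * x + qmat g 1 1 ≠ 0 := fun h => by
  obtain ⟨h0, h1⟩ := rat_linear_eq_zero hx (a := g 1 0) (b := g 1 1) h
  rw [Matrix.det_fin_two, h0, h1] at hg
  simp at hg

lemma moeb_eq_iff {x y : ℂ} (hx : x ∈ HH) {g : Matrix (Fin 2) (Fin 2) ℚ} (hg : 0 < g.det) :
    moeb (qmat g) x = y ↔
      y * ((g 1 0 : ℂ) * x + g 1 1) = (g 0 0 : ℂ) * x + g 0 1 := by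
  have := moeb_denom_ne_zero hx hg
  rw [moeb, div_eq_iff this, eq_comm]
  rfl

lemma GRel.refl (x : ℂ) : GRel x x := ⟨1, by simp, by simp [moeb, qmat]⟩

lemma GRel.mem_HH {x y : ℂ} (hx : x ∈ HH) (h : GRel x y) : y ∈ HH := by
  obtain ⟨g, hg, rfl⟩ := h
  have hd := moeb_denom_ne_zero hx hg
  have hx' : 0 < x.im := hx
  have hn : 0 < Complex.normSq (qmat g 1 0 * x + qmat g 1 1) := Complex.normSq_pos.2 hd
  change 0 < (moeb (qmat g) x).im
  have hdet : (0 : ℝ) < g 0 0 * g 1 1 - g 0 1 * g 1 0 := by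
    rw [Matrix.det_fin_two] at hg; exact_mod_cast hg
  have key : (moeb (qmat g) x).im = (g 0 0 * g 1 1 - g 0 1 * g 1 0) * x.im /
      Complex.normSq (qmat g 1 0 * x + qmat g 1 1) := by
    rw [moeb, Complex.div_im]
    field_simp
    simp [qmat]
    ring
  rw [key]
  positivity

lemma GRel.symm {x y : ℂ} (hx : x ∈ HH) (h : GRel x y) : GRel y x := by
  have hy := h.mem_HH hx
  obtain ⟨g, hg, hgx⟩ := h
  have hadj : 0 < g.adjugate.det := by simpa [Matrix.det_adjugate] using hg
  refine ⟨g.adjugate, hadj, (moeb_eq_iff hy hadj).2 ?_⟩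
  have h1 := (moeb_eq_iff hx hg).1 hgx
  simp only [Matrix.adjugate_fin_two, Matrix.of_apply, Matrix.cons_val_zero, Matrix.cons_val_one,
    Rat.cast_neg, Matrix.cons_val', Matrix.cons_val_fin_one]
  linear_combination -h1

lemma GRel.trans {x y z : ℂ} (hx : x ∈ HH) (h : GRel x y) (h' : GRel y z) : GRel x z := by
  have hy := h.mem_HH hx
  obtain ⟨g, hg, hgx⟩ := h
  obtain ⟨g', hg', hgy⟩ := h'
  have hdet : 0 < (g' * g).det := by rw [Matrix.det_mul]; positivity
  refine ⟨g' * g, hdet, (moeb_eq_iff hx hdet).2 ?_⟩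
  have h1 := (moeb_eq_iff hx hg).1 hgx
  have h2 := (moeb_eq_iff hy hg').1 hgy
  simp only [Matrix.mul_apply, Fin.sum_univ_two, Rat.cast_add, Rat.cast_mul]
  linear_combination ((g 1 0 : ℂ) * x + g 1 1) * h2 + (g' 0 0 - z * g' 1 0) * h1

lemma GRel.gorb_eq {x y : ℂ} (hx : x ∈ HH) (h : GRel x y) : Gorb x = Gorb y :=
  Set.ext fun _ => ⟨fun hz => (h.symm hx).trans (h.mem_HH hx) hz, fun hz => h.trans hx hz⟩

lemma GRel.of_gorb_eq {x y : ℂ} (h : Gorb x = Gorb y) : GRel x y := by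
  have : y ∈ Gorb y := GRel.refl y
  rwa [← h] at this

lemma GRel.mem_subfield {E : Subfield ℂ} {x y : ℂ} (h : GRel x y) (hx : x ∈ E) : y ∈ E := by
  obtain ⟨g, -, rfl⟩ := h
  have hq : ∀ a b, qmat g a b ∈ E := fun a b => SubfieldClass.ratCast_mem E (g a b)
  exact div_mem (add_mem (mul_mem (hq _ _) hx) (hq _ _)) (add_mem (mul_mem (hq _ _) hx) (hq _ _))

lemma isAlgebraic_of_mem_SigmaSet {x : ℂ} (hx : x ∈ SigmaSet) : IsAlgebraic ℚ x := by
  by_contra h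
  have := minpoly.eq_zero (A := ℚ) (x := x) fun h' => h h'.isAlgebraic
  have h2 := hx.2
  rw [this] at h2
  simp at h2

lemma mem_of_isAlgebraic_rat {E : Subfield ℂ} (hE : ∀ x : ℂ, IsAlgebraic E x → x ∈ E) {x : ℂ}
    (hx : IsAlgebraic ℚ x) : x ∈ E :=
  hE x (hx.tower_top E)

lemma isAlgebraic_rat_of_GRel_SigmaSet {x c : ℂ} (hx : x ∈ HH) (hc : c ∈ SigmaSet)
    (h : GRel x c) : IsAlgebraic ℚ x := by
  have := (h.symm hx).mem_subfield (E := (algebraicClosure ℚ ℂ).toSubfield)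
    ((mem_algebraicClosure_iff).2 (isAlgebraic_of_mem_SigmaSet hc))
  exact (mem_algebraicClosure_iff).1 this

lemma eq_scalar_of_moeb_eq_self {x : ℂ} (hx : x ∈ HH) (hxS : x ∉ SigmaSet)
    {g : Matrix (Fin 2) (Fin 2) ℚ} (hg : 0 < g.det) (h : moeb (qmat g) x = x) :
    g 1 0 = 0 ∧ g 0 1 = 0 ∧ g 0 0 = g 1 1 := by
  rw [moeb_eq_iff hx hg] at h
  by_cases hc : g 1 0 = 0
  · have := rat_linear_eq_zero hx (a := g 1 1 - g 0 0) (b := - g 0 1)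
      (by rw [hc] at h; push_cast at h ⊢; linear_combination h)
    exact ⟨hc, by linarith [this.2], by linarith [this.1]⟩
  · refine absurd ⟨hx, ?_⟩ hxS
    let p : Polynomial ℚ := Polynomial.C (g 1 0) * Polynomial.X ^ 2
      + Polynomial.C (g 1 1 - g 0 0) * Polynomial.X + Polynomial.C (- g 0 1)
    have hp : p.natDegree = 2 := Polynomial.natDegree_quadratic hc
    have hpx : Polynomial.aeval x p = 0 := by
      simp only [p, map_add, map_mul, Polynomial.aeval_C, map_pow, Polynomial.aeval_X,
        eq_ratCast]
      push_cast
      linear_combination h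
    have hp0 : p ≠ 0 := fun h0 => by simp [h0] at hp
    have hint : IsIntegral ℚ x := IsAlgebraic.isIntegral ⟨p, hp0, hpx⟩
    apply le_antisymm
    · rw [← hp]; exact Polynomial.natDegree_le_of_dvd (minpoly.dvd ℚ x hpx) hp0
    · rw [minpoly.two_le_natDegree_iff hint]
      rintro ⟨q, hq⟩
      have hx' : 0 < x.im := hx
      rw [← hq] at hx'
      simp at hx'

instance : Countable (Matrix (Fin 2) (Fin 2) ℚ) :=
  inferInstanceAs (Countable (Fin 2 → Fin 2 → ℚ))

section

/-- The `ℂ`-vector space of `j`-derivations. -/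
def jDer (j : ℂ → ℂ) : Submodule ℂ (ℂ → ℂ) where
  carrier := {D | IsJDeriv j D}
  zero_mem' := ⟨by simp, by simp, by simp⟩
  add_mem' := by
    rintro D E ⟨h1, h2, h3⟩ ⟨k1, k2, k3⟩
    refine ⟨fun a b => ?_, fun a b => ?_, fun z hz k => ?_⟩ <;> simp only [Pi.add_apply]
    · rw [h1, k1]; ring
    · rw [h2, k2]; ring
    · rw [h3 z hz, k3 z hz]; ring
  smul_mem' := by
    rintro c D ⟨h1, h2, h3⟩
    refine ⟨fun a b => ?_, fun a b => ?_, fun z hz k => ?_⟩ <;>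
      simp only [Pi.smul_apply, smul_eq_mul]
    · rw [h1]; ring
    · rw [h2]; ring
    · rw [h3 z hz]; ring

variable {j D : ℂ → ℂ}

/-- The field of constants of a `j`-derivation. -/
def IsJDeriv.ker (hD : IsJDeriv j D) : Subfield ℂ where
  carrier := {x | D x = 0}
  mul_mem' := fun {a b} ha hb => by
    change D (a * b) = 0
    rw [hD.2.1, show D a = 0 from ha, show D b = 0 from hb]; ring
  one_mem' := by
    have := hD.2.1 1 1
    simpa using this
  add_mem' := fun {a b} ha hb => by
    change D (a + b) = 0
    rw [hD.1, show D a = 0 from ha, show D b = 0 from hb]; ring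
  zero_mem' := by
    have := hD.1 0 0
    simpa using this
  neg_mem' := fun {a} ha => by
    have h0 : D 0 = 0 := by
      have := hD.1 0 0
      simpa using this
    have h := hD.1 a (-a)
    rw [add_neg_cancel, h0, show D a = 0 from ha, zero_add] at h
    exact h.symm
  inv_mem' := fun a ha => by
    have h1 : D 1 = 0 := by
      have := hD.2.1 1 1
      simpa using this
    have h0 : D 0 = 0 := by
      have := hD.1 0 0
      simpa using this
    change D a⁻¹ = 0
    rcases eq_or_ne a 0 with rfl | hne
    · simpa using h0
    · have h := hD.2.1 a a⁻¹
      rw [mul_inv_cancel₀ hne, h1, show D a = 0 from ha, mul_zero, add_zero] at h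
      exact (mul_eq_zero.1 h.symm).resolve_left hne

lemma IsJDeriv.mem_ker (hD : IsJDeriv j D) {x : ℂ} : x ∈ hD.ker ↔ D x = 0 := Iff.rfl

/-- A `j`-derivation as a derivation over any of its fields of constants. -/
def IsJDeriv.toDerivation (hD : IsJDeriv j D) (K : Subfield ℂ) (hK : K ≤ hD.ker) :
    Derivation K ℂ ℂ :=
  Derivation.mk' { toFun := D
                   map_add' := hD.1
                   map_smul' := fun a x => by
                    change D (a * x) = a * D x
                    rw [hD.2.1, hD.mem_ker.1 (hK a.2)]; ring } hD.2.1

lemma IsJDeriv.mem_ker_of_isAlgebraic (hD : IsJDeriv j D) (x : ℂ) (hx : IsAlgebraic hD.ker x) :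
    x ∈ hD.ker := by
  let d := hD.toDerivation hD.ker le_rfl
  have hint := hx.isIntegral
  have h1 : d (Polynomial.aeval x (minpoly hD.ker x)) = 0 := by
    rw [minpoly.aeval]; exact map_zero d
  rw [Derivation.map_aeval] at h1
  exact (smul_eq_zero.1 h1).resolve_left
    ((minpoly.irreducible hint).separable.aeval_derivative_ne_zero (minpoly.aeval _ _))

lemma IsJDeriv.acl_le_ker (hD : IsJDeriv j D) {A : Set ℂ} (hA : ∀ a ∈ A, D a = 0) :
    acl ⊥ A ≤ hD.ker :=
  acl_le hD.mem_ker_of_isAlgebraic bot_le hA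

lemma IsJDeriv.eq_zero_of_GRel_SigmaSet (hD : IsJDeriv j D) {x c : ℂ} (hx : x ∈ HH)
    (hc : c ∈ SigmaSet) (h : GRel x c) : D x = 0 :=
  mem_of_isAlgebraic_rat hD.mem_ker_of_isAlgebraic (isAlgebraic_rat_of_GRel_SigmaSet hx hc h)

lemma IsJDeriv.eq_zero_of_GRel (hD : IsJDeriv j D) {x y : ℂ} (h : GRel x y) (hx : D x = 0) :
    D y = 0 :=
  h.mem_subfield (E := hD.ker) hx

lemma dimjGE_dimj (j : ℂ → ℂ) (A B : Set ℂ) : dimjGE j A B (dimj j A B) := by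
  by_cases h : BddAbove {n | dimjGE j A B n}
  · exact Nat.sSup_mem (s := {n | dimjGE j A B n})
      ⟨0, Fin.elim0, Fin.elim0, fun i => i.elim0, fun i => i.elim0, fun i => i.elim0⟩ h
  · rw [dimj, Nat.sSup_of_not_bddAbove h]
    exact ⟨Fin.elim0, Fin.elim0, fun i => i.elim0, fun i => i.elim0, fun i => i.elim0⟩

end

/-- Polynomials over the prime field in the jet coordinates `x i, j (x i), j' (x i), …`. -/
abbrev JetPoly (κ : Type*) : Type _ := MvPolynomial (ℕ × κ) (⊥ : Subfield ℂ)

/-- The jet coordinates of a point: `(0, i)` is `x i` and `(k + 1, i)` is `j⁽ᵏ⁾ (x i)`. -/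
def jet (j : ℂ → ℂ) {κ : Type*} (x : κ → ℂ) : ℕ × κ → ℂ
  | (0, i) => x i
  | (k + 1, i) => deriv^[k] j (x i)

/-- The value of a jet polynomial at a point. -/
def jetEval (j : ℂ → ℂ) {κ : Type*} (x : κ → ℂ) : JetPoly κ →ₐ[(⊥ : Subfield ℂ)] ℂ :=
  MvPolynomial.aeval (jet j x)

/-- The formal partial derivative of a jet polynomial with respect to `x l`. -/
def jetPartial {κ : Type*} [DecidableEq κ] (l : κ) :
    Derivation (⊥ : Subfield ℂ) (JetPoly κ) (JetPoly κ) :=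
  MvPolynomial.mkDerivation _ fun p =>
    if p.2 = l then (if p.1 = 0 then 1 else MvPolynomial.X (p.1 + 1, p.2)) else 0

/-- The gradient of a jet polynomial at a point. -/
def jetGrad (j : ℂ → ℂ) {κ : Type*} [DecidableEq κ] (x : κ → ℂ) (P : JetPoly κ) : κ → ℂ :=
  fun l => jetEval j x (jetPartial l P)

section
variable {j : ℂ → ℂ} {κ : Type*}

@[simp] lemma jetEval_X (x : κ → ℂ) (p : ℕ × κ) : jetEval j x (MvPolynomial.X p) = jet j x p :=
  MvPolynomial.aeval_X _ _

@[simp] lemma jetPartial_X [DecidableEq κ] (l : κ) (p : ℕ × κ) :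
    jetPartial l (MvPolynomial.X p) =
      if p.2 = l then (if p.1 = 0 then 1 else MvPolynomial.X (p.1 + 1, p.2)) else 0 :=
  MvPolynomial.mkDerivation_X _ _ _

lemma isOpen_HH : IsOpen HH := isOpen_lt continuous_const Complex.continuous_im

lemma analyticAt_iterate_deriv (hj : DifferentiableOn ℂ j HH) (k : ℕ) {z : ℂ} (hz : z ∈ HH) :
    AnalyticAt ℂ (deriv^[k] j) z := by
  induction k generalizing z with
  | zero => exact hj.analyticAt (isOpen_HH.mem_nhds hz)
  | succ k ih => rw [Function.iterate_succ_apply']; exact (ih hz).deriv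

variable [Fintype κ]

lemma analyticAt_jet (hj : DifferentiableOn ℂ j HH) {x : κ → ℂ} (hx : ∀ i, x i ∈ HH)
    (p : ℕ × κ) : AnalyticAt ℂ (fun y => jet j y p) x := by
  obtain ⟨k, i⟩ := p
  have hi : AnalyticAt ℂ (fun y : κ → ℂ => y i) x :=
    (ContinuousLinearMap.proj (R := ℂ) (φ := fun _ : κ => ℂ) i).analyticAt x
  cases k with
  | zero => exact hi
  | succ k => exact AnalyticAt.fun_comp (g := deriv^[k] j) (analyticAt_iterate_deriv hj k (hx i)) hi

lemma analyticAt_jetEval (hj : DifferentiableOn ℂ j HH) {x : κ → ℂ} (hx : ∀ i, x i ∈ HH)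
    (P : JetPoly κ) : AnalyticAt ℂ (fun y => jetEval j y P) x :=
  AnalyticAt.aeval_mvPolynomial (fun p => analyticAt_jet hj hx p) P

/-- The continuous linear functional `v ↦ ∑ l, g l * v l`. -/
def dotCLM (g : κ → ℂ) : (κ → ℂ) →L[ℂ] ℂ :=
  LinearMap.toContinuousLinearMap (Fintype.linearCombination ℂ g)

lemma dotCLM_apply (g v : κ → ℂ) : dotCLM g v = ∑ l, g l * v l := by
  simp [dotCLM, Fintype.linearCombination_apply, mul_comm]

variable [DecidableEq κ]

lemma hasFDerivAt_jet (hj : DifferentiableOn ℂ j HH) {x : κ → ℂ} (hx : ∀ i, x i ∈ HH)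
    (p : ℕ × κ) :
    HasFDerivAt (fun y => jet j y p) (dotCLM (jetGrad j x (MvPolynomial.X p))) x := by
  obtain ⟨k, i⟩ := p
  have hi : HasFDerivAt (fun y : κ → ℂ => y i)
    (ContinuousLinearMap.proj (R := ℂ) (φ := fun _ : κ => ℂ) i) x :=
    (ContinuousLinearMap.proj (R := ℂ) (φ := fun _ : κ => ℂ) i).hasFDerivAt
  cases k with
  | zero =>
    refine hi.congr_fderiv (ContinuousLinearMap.ext fun v => ?_)
    rw [dotCLM_apply, Finset.sum_eq_single i]
    · simp [jetGrad]
    · intro l _ hl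
      simp [jetGrad, hl.symm]
    · simp
  | succ k =>
    have h := (analyticAt_iterate_deriv hj k (hx i)).differentiableAt.hasDerivAt.comp_hasFDerivAt
      x hi
    refine h.congr_fderiv (ContinuousLinearMap.ext fun v => ?_)
    rw [dotCLM_apply, Finset.sum_eq_single i]
    · simp [jetGrad, jet, ← Function.iterate_succ_apply', -Function.iterate_succ]
    · intro l _ hl
      simp [jetGrad, hl.symm]
    · simp

lemma hasFDerivAt_jetEval (hj : DifferentiableOn ℂ j HH) {x : κ → ℂ} (hx : ∀ i, x i ∈ HH)
    (P : JetPoly κ) : HasFDerivAt (fun y => jetEval j y P) (dotCLM (jetGrad j x P)) x := by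
  induction P using MvPolynomial.induction_on with
  | C a =>
    simp only [jetEval, MvPolynomial.aeval_C]
    refine (hasFDerivAt_const _ _).congr_fderiv (ContinuousLinearMap.ext fun v => ?_)
    simp [dotCLM_apply, jetGrad, MvPolynomial.derivation_C]
  | add p q hp hq =>
    simp only [map_add]
    refine (hp.add hq).congr_fderiv (ContinuousLinearMap.ext fun v => ?_)
    simp [dotCLM_apply, jetGrad, add_mul, Finset.sum_add_distrib]
  | mul_X p n hp =>
    simp only [map_mul, jetEval_X]
    refine (hp.mul (hasFDerivAt_jet hj hx n)).congr_fderiv (ContinuousLinearMap.ext fun v => ?_)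
    simp only [add_apply, smul_apply, dotCLM_apply, smul_eq_mul,
      jetGrad, Derivation.leibniz, map_add, map_mul, jetEval_X, Finset.mul_sum,
      ← Finset.sum_add_distrib]
    exact Finset.sum_congr rfl fun l _ => by ring

/-- A `j`-derivation satisfies the chain rule on jet polynomials. -/
lemma IsJDeriv.jetEval {D : ℂ → ℂ} (hD : IsJDeriv j D) {x : κ → ℂ} (hx : ∀ i, x i ∈ HH)
    (P : JetPoly κ) : D (jetEval j x P) = ∑ l, jetGrad j x P l * D (x l) := by
  induction P using MvPolynomial.induction_on with
  | C a =>
    simp only [jetGrad, MvPolynomial.derivation_C, map_zero, zero_mul, Finset.sum_const_zero,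
      ModularJPaper.jetEval, MvPolynomial.aeval_C]
    exact hD.mem_ker.1 ((bot_le : (⊥ : Subfield ℂ) ≤ hD.ker) a.2)
  | add p q hp hq =>
    simp only [jetGrad, map_add, add_mul, Finset.sum_add_distrib, hD.1]
    simp only [jetGrad] at hp hq
    rw [hp, hq]
  | mul_X p n hp =>
    have hn : D (jet j x n) = ∑ l, jetGrad j x (MvPolynomial.X n) l * D (x l) := by
      obtain ⟨k, i⟩ := n
      rw [Finset.sum_eq_single i]
      · cases k with
        | zero => simp [jetGrad, jet]
        | succ k =>
          simp only [jetGrad, jetPartial_X, jet]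
          simpa [jet] using hD.2.2 _ (hx i) k
      · intro l _ hl
        simp [jetGrad, hl.symm]
      · simp
    rw [map_mul, hD.2.1, hp, jetEval_X, hn, Finset.mul_sum, Finset.mul_sum,
      ← Finset.sum_add_distrib]
    refine Finset.sum_congr rfl fun l _ => ?_
    simp only [jetGrad, Derivation.leibniz, map_add, smul_eq_mul, map_mul, jetEval_X]
    ring

end

open Filter Topology in
lemma natCast_le_analyticOrderAt_sum {ι : Type*} (s : Finset ι) {f : ι → ℂ → ℂ} {z : ℂ} {n : ℕ∞}
    (h : ∀ i ∈ s, n ≤ analyticOrderAt (f i) z) :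
    n ≤ analyticOrderAt (fun x => ∑ i ∈ s, f i x) z := by
  classical
  induction s using Finset.induction_on with
  | empty =>
    have : analyticOrderAt (fun _ : ℂ => (0 : ℂ)) z = ⊤ := analyticOrderAt_eq_top.2 (by simp)
    simp [this]
  | insert a s ha ih =>
    have := le_analyticOrderAt_add (f := f a) (g := fun x => ∑ i ∈ s, f i x) (z₀ := z)
    simp only [Finset.sum_insert ha]
    refine le_trans (le_min (h a (by simp)) (ih fun i hi => h i (by simp [hi]))) this

section
variable {j : ℂ → ℂ} {κ : Type*} [Fintype κ]

lemma analyticAt_curve {U : Set ℂ} (hU : IsOpen U) {γ : ℂ → κ → ℂ} (hγ : DifferentiableOn ℂ γ U)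
    (hj : DifferentiableOn ℂ j HH) (hH : ∀ s ∈ U, ∀ i, γ s i ∈ HH) (P : JetPoly κ) {s : ℂ}
    (hs : s ∈ U) : AnalyticAt ℂ (fun s => jetEval j (γ s) P) s :=
  AnalyticAt.fun_comp (g := fun x => jetEval j x P) (analyticAt_jetEval hj (hH s hs) P)
    (hγ.analyticAt (hU.mem_nhds hs))

variable [DecidableEq κ]

/-- The matrix of formal partial derivatives of a family of jet polynomials. -/
def jetJacobian (F : κ → JetPoly κ) : Matrix κ κ (JetPoly κ) :=
  Matrix.of fun i l => jetPartial l (F i)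

lemma hasDerivAt_curve {U : Set ℂ} (hU : IsOpen U) {γ : ℂ → κ → ℂ} (hγ : DifferentiableOn ℂ γ U)
    (hj : DifferentiableOn ℂ j HH) (hH : ∀ s ∈ U, ∀ i, γ s i ∈ HH) (P : JetPoly κ) {s : ℂ}
    (hs : s ∈ U) : HasDerivAt (fun s => jetEval j (γ s) P) (jetGrad j (γ s) P ⬝ᵥ deriv γ s) s := by
  have h := (hasFDerivAt_jetEval hj (hH s hs) P).comp_hasDerivAt s
    (hγ.differentiableAt (hU.mem_nhds hs)).hasDerivAt
  rwa [dotCLM_apply] at h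

open Filter Topology in
/-- Along a curve with all but the directions `Aᶜ` of the flow of `F` frozen, every jet polynomial
whose gradient at the base point is conormal to the tangent space is constant. -/
lemma jetEval_curve_eq {U : Set ℂ} (hU : IsOpen U) (hUc : IsPreconnected U) (h0 : (0 : ℂ) ∈ U)
    {γ : ℂ → κ → ℂ} (hγ : DifferentiableOn ℂ γ U)
    (hj : DifferentiableOn ℂ j HH) (hH : ∀ s ∈ U, ∀ i, γ s i ∈ HH)
    {F : κ → JetPoly κ} {e : κ → ℂ}
    (hFγ : ∀ s ∈ U, ∀ i, jetEval j (γ s) (F i) = jetEval j (γ 0) (F i) + s * e i)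
    {A : Set κ} (heA : ∀ i ∈ A, e i = 0)
    (hspan : ∀ P, jetEval j (γ 0) P = 0 → ∀ y, (∀ i ∈ A, jetGrad j (γ 0) (F i) ⬝ᵥ y = 0) →
      jetGrad j (γ 0) P ⬝ᵥ y = 0)
    (hdet : jetEval j (γ 0) (jetJacobian F).det ≠ 0) {P : JetPoly κ}
    (hP : ∀ y, (∀ i ∈ A, jetGrad j (γ 0) (F i) ⬝ᵥ y = 0) → jetGrad j (γ 0) P ⬝ᵥ y = 0)
    {s : ℂ} (hs : s ∈ U) : jetEval j (γ s) P = jetEval j (γ 0) P := by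
  -- the Cramer numerators
  let g : JetPoly κ → κ → JetPoly κ := fun P i => ∑ l, jetPartial l P * (jetJacobian F).adjugate l i
  let d : JetPoly κ := (jetJacobian F).det
  have hmul : ∀ x : κ → ℂ, ∀ i : κ, ∀ y : κ → ℂ,
      (((jetJacobian F).map (jetEval j x)).mulVec y) i = jetGrad j x (F i) ⬝ᵥ y := fun x i y => rfl
  have hgev : ∀ (x : κ → ℂ) (P : JetPoly κ) (i : κ), jetEval j x (g P i) =
      jetGrad j x P ⬝ᵥ fun l => ((jetJacobian F).map (jetEval j x)).adjugate l i := fun x P i => by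
    have := RingHom.map_adjugate (jetEval j x : JetPoly κ →+* ℂ) (jetJacobian F)
    have h2 : ∀ l, jetEval j x ((jetJacobian F).adjugate l i) =
      ((jetJacobian F).map (jetEval j x)).adjugate l i := fun l => congrFun (congrFun this l) i
    simp only [g, map_sum, map_mul, h2]
    rfl
  have hdev : ∀ x : κ → ℂ, jetEval j x d = ((jetJacobian F).map (jetEval j x)).det := fun x =>
    RingHom.map_det (jetEval j x : JetPoly κ →+* ℂ) (jetJacobian F)
  -- differentiating along the curve
  have hder : ∀ P, ∀ s ∈ U, jetEval j (γ s) d * deriv (fun s => jetEval j (γ s) P) s =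
      ∑ i, e i * jetEval j (γ s) (g P i) := fun P s hs => by
    have hM : ((jetJacobian F).map (jetEval j (γ s))).mulVec (deriv γ s) = e := by
      ext i
      rw [hmul, ← (hasDerivAt_curve hU hγ hj hH (F i) hs).deriv]
      have : (fun s => jetEval j (γ s) (F i)) =ᶠ[𝓝 s]
          fun s => jetEval j (γ 0) (F i) + s * e i :=
        Filter.eventually_of_mem (hU.mem_nhds hs) fun s hs => hFγ s hs i
      rw [this.deriv_eq]
      simp
    have hadj : jetEval j (γ s) d • deriv γ s =
        ((jetJacobian F).map (jetEval j (γ s))).adjugate.mulVec e := by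
      rw [← hM, Matrix.mulVec_mulVec, Matrix.adjugate_mul, hdev, Matrix.smul_mulVec,
        Matrix.one_mulVec]
    rw [(hasDerivAt_curve hU hγ hj hH P hs).deriv, ← smul_eq_mul, ← dotProduct_smul, hadj]
    simp only [hgev, Matrix.mulVec, dotProduct, Finset.mul_sum]
    rw [Finset.sum_comm]
    exact Finset.sum_congr rfl fun i _ => Finset.sum_congr rfl fun l _ => by ring
  have hg0 : ∀ P, (∀ y, (∀ i ∈ A, jetGrad j (γ 0) (F i) ⬝ᵥ y = 0) → jetGrad j (γ 0) P ⬝ᵥ y = 0) →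
      ∀ i ∉ A, jetEval j (γ 0) (g P i) = 0 := fun P hP i hi => by
    rw [hgev]
    refine hP _ fun k hk => ?_
    have := congrFun (congrFun (Matrix.mul_adjugate ((jetJacobian F).map (jetEval j (γ 0)))) k) i
    rw [Matrix.smul_apply, Matrix.one_apply_ne (by rintro rfl; exact hi hk), smul_zero] at this
    exact this
  have hord : ∀ n : ℕ, ∀ P,
      (∀ y, (∀ i ∈ A, jetGrad j (γ 0) (F i) ⬝ᵥ y = 0) → jetGrad j (γ 0) P ⬝ᵥ y = 0) →
      (n : ℕ∞) ≤ analyticOrderAt (fun s => jetEval j (γ s) P - jetEval j (γ 0) P) 0 := fun n => by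
    induction n with
    | zero => simp
    | succ n ih =>
      intro P hP
      have han : AnalyticAt ℂ (fun s => jetEval j (γ s) P - jetEval j (γ 0) P) 0 :=
        (analyticAt_curve hU hγ hj hH P h0).sub analyticAt_const
      rw [Nat.cast_succ, ← analyticOrderAt_deriv_ge_iff han (by simp)]
      have hd0 : analyticOrderAt (fun s => jetEval j (γ s) d) 0 = 0 :=
        (analyticAt_curve hU hγ hj hH d h0).analyticOrderAt_eq_zero.2 hdet
      rw [← zero_add (analyticOrderAt (deriv _) 0), ← hd0,
        ← analyticOrderAt_mul (analyticAt_curve hU hγ hj hH d h0) han.deriv]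
      have heq : ((fun s => jetEval j (γ s) d) *
          deriv fun s => jetEval j (γ s) P - jetEval j (γ 0) P) =ᶠ[𝓝 0]
          fun s => ∑ i, e i * jetEval j (γ s) (g P i) := by
        filter_upwards [hU.mem_nhds h0] with s hs
        rw [Pi.mul_apply, deriv_sub_const, hder P s hs]
      rw [analyticOrderAt_congr heq]
      refine natCast_le_analyticOrderAt_sum _ fun i _ => ?_
      by_cases hi : i ∈ A
      · have : analyticOrderAt (fun s => e i * jetEval j (γ s) (g P i)) 0 = ⊤ :=
          analyticOrderAt_eq_top.2 (by simp [heA i hi])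
        simp [this]
      · have hgi := hg0 P hP i hi
        have h1 := ih (g P i) (hspan _ hgi)
        simp only [hgi, sub_zero] at h1
        change (n : ℕ∞) ≤ analyticOrderAt ((fun _ => e i) * fun s => jetEval j (γ s) (g P i)) 0
        rw [analyticOrderAt_mul analyticAt_const (analyticAt_curve hU hγ hj hH _ h0)]
        exact h1.trans le_add_self
  have htop : analyticOrderAt (fun s => jetEval j (γ s) P - jetEval j (γ 0) P) 0 = ⊤ :=
    ENat.eq_top_iff_forall_ge.2 fun n => hord n P hP
  have := AnalyticOnNhd.eqOn_zero_of_preconnected_of_eventuallyEq_zero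
    (f := fun s => jetEval j (γ s) P - jetEval j (γ 0) P) (U := U)
    (fun s hs => (analyticAt_curve hU hγ hj hH P hs).sub analyticAt_const) hUc h0
    (analyticOrderAt_eq_top.1 htop) hs
  exact sub_eq_zero.1 this

open Filter Topology in
lemma exists_curve (hj : DifferentiableOn ℂ j HH) {w : κ → ℂ} (hw : ∀ i, w i ∈ HH)
    {F : κ → JetPoly κ} (hdet : jetEval j w (jetJacobian F).det ≠ 0) (v : κ → ℂ) :
    ∃ ε > 0, ∃ γ : ℂ → κ → ℂ, DifferentiableOn ℂ γ (Metric.ball 0 ε) ∧ γ 0 = w ∧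
      deriv γ 0 = v ∧ (∀ s ∈ Metric.ball (0 : ℂ) ε, ∀ i, γ s i ∈ HH) ∧
      ∀ s ∈ Metric.ball (0 : ℂ) ε, ∀ i,
        jetEval j (γ s) (F i) = jetEval j w (F i) + s * (jetGrad j w (F i) ⬝ᵥ v) := by
  let Φ : (κ → ℂ) → κ → ℂ := fun x i => jetEval j x (F i)
  let M := (jetJacobian F).map (jetEval j w)
  let Φ' : (κ → ℂ) →L[ℂ] (κ → ℂ) := ContinuousLinearMap.pi fun i => dotCLM (jetGrad j w (F i))
  have hM : (Φ' : (κ → ℂ) →ₗ[ℂ] (κ → ℂ)) = Matrix.toLin' M := by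
    refine LinearMap.ext fun y => ?_
    ext i
    exact dotCLM_apply _ _
  have hΦdet : Φ'.det ≠ 0 := by
    change LinearMap.det (Φ' : (κ → ℂ) →ₗ[ℂ] (κ → ℂ)) ≠ 0
    rw [hM, LinearMap.det_toLin']
    rwa [show jetEval j w (jetJacobian F).det = M.det from
      RingHom.map_det (jetEval j w : JetPoly κ →+* ℂ) (jetJacobian F)] at hdet
  let L := Φ'.toContinuousLinearEquivOfDetNeZero hΦdet
  have hΦ : HasFDerivAt Φ (L : (κ → ℂ) →L[ℂ] (κ → ℂ)) w := by
    rw [ContinuousLinearMap.coe_toContinuousLinearEquivOfDetNeZero]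
    exact hasFDerivAt_pi.2 fun i => hasFDerivAt_jetEval hj hw (F i)
  have hC : ContDiffAt ℂ 1 Φ w := contDiffAt_pi.2 fun i =>
    (analyticAt_jetEval hj hw (F i)).contDiffAt
  let Ψ := hC.localInverse hΦ one_ne_zero
  have hΨw : Ψ (Φ w) = w := hC.localInverse_apply_image hΦ one_ne_zero
  have hΨC : ContDiffAt ℂ 1 Ψ (Φ w) := hC.to_localInverse hΦ one_ne_zero
  have hΨr : ∀ᶠ y in 𝓝 (Φ w), Φ (Ψ y) = y :=
    (hC.hasStrictFDerivAt' hΦ one_ne_zero).eventually_right_inverse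
  have hΨ' : HasFDerivAt Ψ (L.symm : (κ → ℂ) →L[ℂ] (κ → ℂ)) (Φ w) :=
    (hC.hasStrictFDerivAt' hΦ one_ne_zero).to_localInverse.hasFDerivAt
  let c : ℂ → κ → ℂ := fun s => Φ w + s • L v
  have hc0 : c 0 = Φ w := by simp [c]
  have hc' : ∀ s, HasDerivAt c (L v) s := fun s => by
    have := ((hasDerivAt_id s).smul_const (L v)).const_add (Φ w)
    rwa [one_smul] at this
  have hct : Tendsto c (𝓝 0) (𝓝 (Φ w)) := by
    have := (hc' 0).continuousAt.tendsto
    rwa [hc0] at this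
  have hHH : ∀ᶠ y in 𝓝 (Φ w), ∀ i, Ψ y i ∈ HH := by
    have h1 : Tendsto Ψ (𝓝 (Φ w)) (𝓝 w) := by
      have := hΨC.continuousAt.tendsto
      rwa [hΨw] at this
    refine eventually_all.2 fun i => ?_
    exact ((continuous_apply i).continuousAt.tendsto.comp h1).eventually
      (isOpen_HH.mem_nhds (hw i))
  have hdiff : ∀ᶠ y in 𝓝 (Φ w), DifferentiableAt ℂ Ψ y :=
    (hΨC.eventually (by simp)).mono fun y hy => hy.differentiableAt one_ne_zero
  obtain ⟨ε, hε, hball⟩ := Metric.eventually_nhds_iff_ball.1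
    (hct.eventually (hΨr.and (hHH.and hdiff)))
  refine ⟨ε, hε, fun s => Ψ (c s), fun s hs => ?_, by simp only [hc0, hΨw], ?_,
    fun s hs => (hball s hs).2.1, fun s hs i => ?_⟩
  · exact ((hball s hs).2.2.comp s (hc' s).differentiableAt).differentiableWithinAt
  · rw [← hc0] at hΨ'
    exact (hΨ'.comp_hasDerivAt 0 (hc' 0)).deriv.trans (L.symm_apply_apply v)
  · have h1 := congrFun (hball s hs).1 i
    have h2 : L v i = jetGrad j w (F i) ⬝ᵥ v := dotCLM_apply _ _
    change Φ (Ψ (c s)) i = Φ w i + s * (jetGrad j w (F i) ⬝ᵥ v)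
    rw [h1, ← h2]
    rfl

end

section
variable {κ : Type*} [Fintype κ] [DecidableEq κ]

/-- The Zariski tangent space at `w` of the locus of the jet coordinates of `w`, seen through the
chain rule as a space of vectors in `κ → ℂ`. -/
def jetTangent (j : ℂ → ℂ) (w : κ → ℂ) : Submodule ℂ (κ → ℂ) where
  carrier := {y | ∀ P, jetEval j w P = 0 → jetGrad j w P ⬝ᵥ y = 0}
  zero_mem' P _ := dotProduct_zero _
  add_mem' hx hy P hP := by rw [dotProduct_add, hx P hP, hy P hP, add_zero]
  smul_mem' c x hx P hP := by rw [dotProduct_smul, hx P hP, smul_zero]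

variable {j : ℂ → ℂ}

lemma IsJDeriv.mem_jetTangent {D : ℂ → ℂ} (hD : IsJDeriv j D) {w : κ → ℂ} (hw : ∀ i, w i ∈ HH) :
    (fun i => D (w i)) ∈ jetTangent j w := fun P hP => by
  have h := hD.jetEval hw P
  rw [hP, hD.mem_ker.1 (zero_mem hD.ker)] at h
  exact h.symm

lemma exists_frame (j : ℂ → ℂ) (w : κ → ℂ) : ∃ (F : κ → JetPoly κ) (A : Set κ) (σ : κ → κ),
    (∀ i ∈ A, jetEval j w (F i) = 0) ∧ (∀ i ∉ A, F i = MvPolynomial.X (0, σ i)) ∧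
    (∀ y, (∀ i ∈ A, jetGrad j w (F i) ⬝ᵥ y = 0) → y ∈ jetTangent j w) ∧
    jetEval j w (jetJacobian F).det ≠ 0 := by
  classical
  let s : Set (κ → ℂ) := {u | ∃ P, jetEval j w P = 0 ∧ jetGrad j w P = u}
  obtain ⟨b₁, hb₁s, hb₁span, hb₁li⟩ := exists_linearIndependent ℂ s
  let E : Set (κ → ℂ) := Set.range fun k => Pi.single k (1 : ℂ)
  obtain ⟨b, hbt, hb₁b, hbspan, hbli⟩ := exists_linearIndepOn_id_extension
    (s := b₁) (t := b₁ ∪ E) hb₁li Set.subset_union_left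
  have htop : ⊤ ≤ Submodule.span ℂ (Set.range (Subtype.val : b → κ → ℂ)) := by
    rw [Subtype.range_coe, ← (Pi.basisFun ℂ κ).span_eq, Submodule.span_le]
    rintro _ ⟨k, rfl⟩
    exact hbspan (Or.inr ⟨k, by simp⟩)
  let B : Module.Basis b ℂ (κ → ℂ) := Module.Basis.mk hbli htop
  let e : κ ≃ b := (Pi.basisFun ℂ κ).indexEquiv B
  have hex : ∀ i, ∃ (P : JetPoly κ) (k : κ), jetGrad j w P = e i ∧
      ((e i : κ → ℂ) ∈ b₁ → jetEval j w P = 0) ∧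
      ((e i : κ → ℂ) ∉ b₁ → P = MvPolynomial.X (0, k)) := fun i => by
    by_cases hi : (e i : κ → ℂ) ∈ b₁
    · obtain ⟨P, hP, hPi⟩ := hb₁s hi
      exact ⟨P, i, hPi, fun _ => hP, fun h => absurd hi h⟩
    · obtain ⟨k, hk⟩ := (hbt (e i).2).resolve_left hi
      refine ⟨MvPolynomial.X (0, k), k, ?_, fun h => absurd h hi, fun _ => rfl⟩
      rw [← hk]
      ext l
      simp only [jetGrad, jetPartial_X, if_true, Pi.single_apply]
      by_cases h : k = l
      · simp [h]
      · simp [h, Ne.symm h]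
  choose F σ hF h0 hX using hex
  refine ⟨F, {i | (e i : κ → ℂ) ∈ b₁}, σ, h0, hX, fun y hy P hP => ?_, ?_⟩
  · have h1 : jetGrad j w P ∈ Submodule.span ℂ b₁ := hb₁span ▸ Submodule.subset_span ⟨P, hP, rfl⟩
    generalize jetGrad j w P = u at h1
    induction h1 using Submodule.span_induction with
    | mem u hu =>
      have := hy (e.symm ⟨u, hb₁b hu⟩) (by simpa using hu)
      rw [hF] at this
      simpa using this
    | zero => exact zero_dotProduct _
    | add u v _ _ hu hv => rw [add_dotProduct, hu, hv, add_zero]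
    | smul c u _ hu => rw [smul_dotProduct, hu, smul_zero]
  · have hM : (jetJacobian F).map (jetEval j w) = Matrix.of fun i => (e i : κ → ℂ) := by
      ext i l
      exact congrFun (hF i) l
    rw [show jetEval j w (jetJacobian F).det = ((jetJacobian F).map (jetEval j w)).det from
      RingHom.map_det (jetEval j w : JetPoly κ →+* ℂ) (jetJacobian F), hM, ← isUnit_iff_ne_zero,
      ← Matrix.isUnit_iff_isUnit_det, ← Matrix.linearIndependent_rows_iff_isUnit]
    exact hbli.comp e e.injective

/-- Every tangent vector is the velocity of an analytic curve along which all jet polynomials that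
are infinitesimally constant stay constant, and which moves linearly in a set of coordinates that
separates tangent vectors. -/
theorem exists_jet_curve (hj : DifferentiableOn ℂ j HH) {w : κ → ℂ} (hw : ∀ i, w i ∈ HH) :
    ∃ S : Finset κ, (∀ y ∈ jetTangent j w, (∀ k ∈ S, y k = 0) → y = 0) ∧
      ∀ v ∈ jetTangent j w, ∃ ε > 0, ∃ γ : ℂ → κ → ℂ,
        DifferentiableOn ℂ γ (Metric.ball 0 ε) ∧ γ 0 = w ∧ deriv γ 0 = v ∧
        (∀ s ∈ Metric.ball (0 : ℂ) ε, ∀ i, γ s i ∈ HH) ∧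
        (∀ s ∈ Metric.ball (0 : ℂ) ε, ∀ k ∈ S, γ s k = w k + s * v k) ∧
        ∀ P, (∀ y ∈ jetTangent j w, jetGrad j w P ⬝ᵥ y = 0) →
          ∀ s ∈ Metric.ball (0 : ℂ) ε, jetEval j (γ s) P = jetEval j w P := by
  classical
  obtain ⟨F, A, σ, hA, hX, hspan, hdet⟩ := exists_frame j w
  have hgrad : ∀ i ∉ A, ∀ y, jetGrad j w (F i) ⬝ᵥ y = y (σ i) := fun i hi y => by
    rw [hX i hi, dotProduct, Finset.sum_eq_single (σ i)]
    · simp [jetGrad]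
    · intro l _ hl
      simp [jetGrad, hl.symm]
    · simp
  refine ⟨Finset.univ.filter fun k => ∃ i ∉ A, σ i = k, fun y hy h => ?_, fun v hv => ?_⟩
  · refine Matrix.eq_zero_of_mulVec_eq_zero (M := (jetJacobian F).map (jetEval j w)) ?_ ?_
    · rwa [show jetEval j w (jetJacobian F).det = ((jetJacobian F).map (jetEval j w)).det from
        RingHom.map_det (jetEval j w : JetPoly κ →+* ℂ) (jetJacobian F)] at hdet
    · ext i
      change jetGrad j w (F i) ⬝ᵥ y = 0
      by_cases hi : i ∈ A
      · exact hy _ (hA i hi)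
      · rw [hgrad i hi]
        exact h _ (Finset.mem_filter.2 ⟨Finset.mem_univ _, i, hi, rfl⟩)
  · obtain ⟨ε, hε, γ, hγ, hγ0, hγ', hH, hlin⟩ := exists_curve hj hw hdet v
    refine ⟨ε, hε, γ, hγ, hγ0, hγ', hH, fun s hs k hk => ?_, fun P hP s hs => ?_⟩
    · obtain ⟨i, hi, rfl⟩ := (Finset.mem_filter.1 hk).2
      have h := hlin s hs i
      rwa [hgrad i hi, hX i hi, jetEval_X, jetEval_X] at h
    · subst hγ0
      refine jetEval_curve_eq (e := fun i => jetGrad j (γ 0) (F i) ⬝ᵥ v) (A := A) Metric.isOpen_ball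
        (convex_ball 0 ε).isPreconnected (Metric.mem_ball_self hε) hγ hj hH hlin
        (fun i hi => hv _ (hA i hi)) (fun P hP y hy => hspan y hy P hP) hdet
        (fun y hy => hP y (hspan y hy)) hs

end

lemma exists_dual_of_linearIndependent {V ι : Type*} [AddCommGroup V] [Module ℂ V] [Fintype ι]
    [DecidableEq ι] {f : ι → Module.Dual ℂ V} (hf : LinearIndependent ℂ f) :
    ∃ e : ι → V, ∀ k l, f k (e l) = if k = l then 1 else 0 := by
  let Θ : V →ₗ[ℂ] (ι → ℂ) := LinearMap.pi f
  have hΘ : Function.Surjective Θ := by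
    rw [← LinearMap.range_eq_top]
    by_contra h
    obtain ⟨φ, hφ, hle⟩ := Submodule.exists_le_ker_of_lt_top _ (lt_top_iff_ne_top.2 h)
    have hφs : ∀ x, φ x = ∑ k, x k * φ (Pi.single k 1) := fun x => by
      conv_lhs => rw [← Finset.univ_sum_single x]
      rw [map_sum]
      refine Finset.sum_congr rfl fun k _ => ?_
      rw [← smul_eq_mul, ← map_smul, ← Pi.single_smul, smul_eq_mul, mul_one]
    have h0 : ∑ k, φ (Pi.single k 1) • f k = 0 := LinearMap.ext fun D => by
      have : φ (Θ D) = 0 := hle ⟨D, rfl⟩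
      rw [hφs] at this
      simpa [Θ, mul_comm] using this
    have := Fintype.linearIndependent_iff.1 hf _ h0
    exact hφ (LinearMap.ext fun x =>
      (hφs x).trans (Finset.sum_eq_zero fun k _ => by rw [this k, mul_zero]))
  choose e he using fun l : ι => hΘ (Pi.single l 1)
  refine ⟨e, fun k l => ?_⟩
  have := congrFun (he l) k
  rwa [Pi.single_apply] at this

lemma exists_dual_jDer {κ : Type*} [Fintype κ] [DecidableEq κ] {j : ℂ → ℂ} {w : κ → ℂ}
    (hw : ∀ i, w i ∈ HH) {S : Finset κ}
    (hS : ∀ y ∈ jetTangent j w, (∀ k ∈ S, y k = 0) → y = 0) {d : ℕ} {D : Fin d → ℂ → ℂ}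
    (hD : ∀ i, IsJDeriv j (D i)) (hli : LinearIndependent ℂ fun i k => D i (w k)) :
    ∃ S' ⊆ S, d ≤ S'.card ∧ ∃ E : κ → ℂ → ℂ, ∀ l ∈ S', IsJDeriv j (E l) ∧
      ∀ k ∈ S', E l (w k) = if k = l then 1 else 0 := by
  classical
  let ε : κ → Module.Dual ℂ (jDer j) := fun k =>
    (LinearMap.proj (R := ℂ) (φ := fun _ : ℂ => ℂ) (w k)).comp (jDer j).subtype
  obtain ⟨b, hbS, -, hspan, hbli⟩ := exists_linearIndepOn_extension (K := ℂ) (v := ε)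
    (s := ∅) (t := S) (linearIndepOn_empty ℂ ε) (Set.empty_subset _)
  have hspan' : ∀ D : jDer j, (∀ k ∈ b, D.1 (w k) = 0) → ∀ k ∈ S, D.1 (w k) = 0 :=
    fun D hDb k hk => by
    have h1 : ε k ∈ Submodule.span ℂ (ε '' b) := hspan ⟨k, hk, rfl⟩
    have h2 : ε k D = 0 := by
      generalize ε k = f at h1
      induction h1 using Submodule.span_induction with
      | mem f hf => obtain ⟨l, hl, rfl⟩ := hf; exact hDb l hl
      | zero => rfl
      | add f g _ _ hf hg => rw [LinearMap.add_apply, hf, hg, add_zero]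
      | smul c f _ hf => rw [LinearMap.smul_apply, hf, smul_zero]
    exact h2
  obtain ⟨e, he⟩ := exists_dual_of_linearIndependent (ι := b) hbli
  refine ⟨b.toFinset, fun k hk => hbS (Set.mem_toFinset.1 hk), ?_,
    fun l => if hl : l ∈ b then (e ⟨l, hl⟩).1 else 0, fun l hl => ?_⟩
  · have hli' : LinearIndependent ℂ fun i (k : b) => D i (w k) := by
      rw [Fintype.linearIndependent_iff] at hli ⊢
      refine fun c hc => hli c ?_
      let D' : jDer j := ∑ i, c i • ⟨D i, hD i⟩
      have hD' : ∀ k, D'.1 (w k) = ∑ i, c i * D i (w k) := fun k => by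
        simp [D', Finset.sum_apply]
      have hz := hS _ (IsJDeriv.mem_jetTangent D'.2 hw) (hspan' D' fun k hk => by
        rw [hD']
        simpa [Finset.sum_apply] using congrFun hc ⟨k, hk⟩)
      rw [← hz]
      ext k
      rw [hD']
      simp [Finset.sum_apply]
    have := hli'.fintype_card_le_finrank
    rwa [Module.finrank_fintype_fun_eq_card, Fintype.card_fin, ← Set.toFinset_card] at this
  · rw [Set.mem_toFinset] at hl
    simp only [dif_pos hl]
    refine ⟨(e ⟨l, hl⟩).2, fun k hk => ?_⟩
    have := he ⟨k, Set.mem_toFinset.1 hk⟩ ⟨l, hl⟩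
    simpa [ε] using this

/-- The index of the `k`-th jet coordinate (`k < 4`) of the `i`-th point. -/
def jetIdx {κ : Type*} (p : Fin 4 × κ) : ℕ × κ := (p.1, p.2)

lemma jet_jetIdx (j : ℂ → ℂ) {κ : Type*} (z : κ → ℂ) (p : Fin 4 × κ) :
    jet j z (jetIdx p) = ![z, j ∘ z, deriv j ∘ z, deriv (deriv j) ∘ z] p.1 p.2 := by
  obtain ⟨k, i⟩ := p
  fin_cases k <;> rfl

lemma dimG_eq_card {κ : Type*} [Fintype κ] {z : κ → ℂ} {C : Set ℂ}
    (hinj : ∀ a b, GRel (z a) (z b) → a = b) (hC : ∀ a, ∀ c ∈ C, ¬ GRel (z a) c) :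
    dimG z C = Fintype.card κ := by
  have h : {S : Set ℂ | ∃ i : κ, S = Gorb (z i) ∧ ∀ c ∈ C, ¬ GRel (z i) c} =
      Set.range fun i => Gorb (z i) := by
    ext S
    exact ⟨fun ⟨i, hi, _⟩ => ⟨i, hi.symm⟩, fun ⟨i, hi⟩ => ⟨i, hi.symm, hC i⟩⟩
  rw [dimG, h, ← Set.image_univ, Set.ncard_image_of_injective _ fun a b hab =>
    hinj a b (GRel.of_gorb_eq hab), Set.ncard_univ, Nat.card_eq_fintype_card]

lemma MSCD.card_le {j : ℂ → ℂ} (h : MSCD j) {κ : Type*} [Fintype κ] {z : κ → ℂ}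
    (hz : ∀ i, z i ∈ HH) (hinj : ∀ a b, GRel (z a) (z b) → a = b)
    (hsig : ∀ a, ∀ c ∈ SigmaSet, ¬ GRel (z a) c) {G : Finset ℂ}
    (hG : ∀ p : Fin 4 × κ, jet j z (jetIdx p) ∈ acl ⊥ (G : Set ℂ)) :
    3 * Fintype.card κ ≤ G.card := by
  let e := Fintype.equivFin κ
  have h1 := h _ (z ∘ e.symm) fun i => hz _
  rw [dimG_eq_card (z := z ∘ e.symm) (fun a b hab => e.symm.injective (hinj _ _ hab)) fun a => hsig _,
    Fintype.card_fin] at h1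
  refine h1.trans (trdegF_le fun p => ?_)
  rw [← jet_jetIdx]
  have h2 := hG (p.1, e.symm p.2)
  obtain ⟨k, i⟩ := p
  rw [jet_jetIdx] at h2 ⊢
  fin_cases k <;> exact h2

/-- Algebraic dependence between jet coordinates persists under specialisation away from a proper
closed subset. -/
lemma exists_specialisation {j : ℂ → ℂ} {κ : Type*} {w : κ → ℂ} {t : Set (ℕ × κ)} {y : ℕ × κ}
    (hy : jet j w y ∈ acl ⊥ (jet j w '' t)) :
    ∃ C : JetPoly κ, jetEval j w C ≠ 0 ∧ ∀ x : κ → ℂ,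
      (∀ P, jetEval j w P = 0 → jetEval j x P = 0) → jetEval j x C ≠ 0 →
      jet j x y ∈ acl ⊥ (jet j x '' t) := by
  let R := Algebra.adjoin (⊥ : Subfield ℂ) ((MvPolynomial.X : ℕ × κ → JetPoly κ) '' t)
  have hmap : ∀ x : κ → ℂ, R.map (jetEval j x) = Algebra.adjoin (⊥ : Subfield ℂ) (jet j x '' t) :=
    fun x => by
      rw [AlgHom.map_adjoin, Set.image_image]
      simp only [jetEval_X]
  have hmem : ∀ (x : κ → ℂ) (r : R),
      jetEval j x r ∈ Algebra.adjoin (⊥ : Subfield ℂ) (jet j x '' t) := fun x r => by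
    rw [← hmap]
    exact ⟨r, r.2, rfl⟩
  let φ : ∀ x : κ → ℂ, R →+* Algebra.adjoin (⊥ : Subfield ℂ) (jet j x '' t) := fun x =>
    (((jetEval j x).comp R.val).codRestrict _ (hmem x)).toRingHom
  have hφ : ∀ x r, (φ x r : ℂ) = jetEval j x r := fun _ _ => rfl
  have hsurj : Function.Surjective (φ w) := fun a => by
    obtain ⟨r, hr, hra⟩ := (hmap w).ge a.2
    exact ⟨⟨r, hr⟩, Subtype.ext hra⟩
  obtain ⟨f, hf0, hf⟩ := mem_acl.1 hy
  obtain ⟨g, rfl⟩ := Polynomial.map_surjective _ hsurj f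
  have heval : ∀ x, Polynomial.aeval (jet j x y) (g.map (φ x)) =
      jetEval j x (Polynomial.eval₂ R.subtype (MvPolynomial.X y) g) := fun x => by
    rw [Polynomial.aeval_def, Polynomial.eval₂_map, Polynomial.eval₂_eq_sum_range,
      Polynomial.eval₂_eq_sum_range, map_sum]
    refine Finset.sum_congr rfl fun i _ => ?_
    rw [map_mul, map_pow, jetEval_X]
    rfl
  obtain ⟨n, hn⟩ : ∃ n, (g.map (φ w)).coeff n ≠ 0 := by
    by_contra! h
    exact hf0 (Polynomial.ext h)
  refine ⟨g.coeff n, fun h => hn ?_, fun x hx hC => ?_⟩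
  · rw [Polynomial.coeff_map]
    exact Subtype.ext h
  · refine mem_acl.2 ⟨g.map (φ x), fun h => hC ?_, ?_⟩
    · have := congrArg (fun q => ((Polynomial.coeff q n : Algebra.adjoin _ _) : ℂ)) h
      simpa [Polynomial.coeff_map, hφ] using this
    · rw [heval]
      exact hx _ (by rw [← heval]; exact hf)

section

open Filter Topology Metric

lemma countable_zeros_of_not_eventuallyEq {f : ℂ → ℂ} {ε : ℝ} (hε : 0 < ε)
    (hf : DifferentiableOn ℂ f (ball 0 ε)) (h0 : ¬ ∀ᶠ s in 𝓝 0, f s = 0) :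
    (ball 0 ε ∩ f ⁻¹' {0}).Countable := by
  have han : AnalyticOnNhd ℂ f (ball 0 ε) := hf.analyticOnNhd isOpen_ball
  obtain ⟨x, hx, hfx⟩ : ∃ x ∈ ball (0 : ℂ) ε, f x ≠ 0 := by
    by_contra! h
    exact h0 (eventually_of_mem (ball_mem_nhds 0 hε) h)
  have hcod := han.preimage_zero_mem_codiscreteWithin hfx hx
    ⟨⟨0, mem_ball_self hε⟩, (convex_ball 0 ε).isPreconnected⟩
  have := isDiscrete_of_codiscreteWithin (U := ball 0 ε) (s := f ⁻¹' {0}) (by simpa using hcod)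
  rw [Set.inter_comm]
  exact (HereditarilyLindelofSpace.isLindelof _).countable_of_isDiscrete this

lemma countable_SigmaSet : SigmaSet.Countable :=
  (Algebraic.countable ℚ ℂ).mono fun _ hx => isAlgebraic_of_mem_SigmaSet hx

lemma exists_generic {β : Type*} [Countable β] {f : β → ℂ → ℂ} {ε : ℝ} (hε : 0 < ε)
    (hf : ∀ b, DifferentiableOn ℂ (f b) (ball 0 ε)) (hH : ∀ b, ∀ s ∈ ball (0 : ℂ) ε, f b s ∈ HH)
    (hsig : ∀ b, ∀ c ∈ SigmaSet, ¬ GRel (f b 0) c)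
    (hpair : ∀ b b', b ≠ b' → GRel (f b 0) (f b' 0) →
      f b 0 = f b' 0 ∧ ¬ ∀ᶠ s in 𝓝 0, f b s = f b' s) :
    ∃ s ∈ ball (0 : ℂ) ε, (∀ b b', GRel (f b s) (f b' s) → b = b') ∧
      ∀ b, ∀ c ∈ SigmaSet, ¬ GRel (f b s) c := by
  let rel (g : Matrix (Fin 2) (Fin 2) ℚ) (x y : ℂ) : ℂ :=
    y * ((g 1 0 : ℂ) * x + g 1 1) - ((g 0 0 : ℂ) * x + g 0 1)
  have hrel : ∀ g : Matrix (Fin 2) (Fin 2) ℚ, 0 < g.det → ∀ x ∈ HH, ∀ y,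
      rel g x y = 0 ↔ moeb (qmat g) x = y := fun g hg x hx y => by
    rw [moeb_eq_iff hx hg, sub_eq_zero]
  have h0 : (0 : ℂ) ∈ ball (0 : ℂ) ε := mem_ball_self hε
  let B₁ (q : β × β × Matrix (Fin 2) (Fin 2) ℚ) : Set ℂ :=
    {s | s ∈ ball 0 ε ∧ q.1 ≠ q.2.1 ∧ 0 < q.2.2.det ∧ rel q.2.2 (f q.1 s) (f q.2.1 s) = 0}
  let B₂ (q : β × SigmaSet × Matrix (Fin 2) (Fin 2) ℚ) : Set ℂ :=
    {s | s ∈ ball 0 ε ∧ 0 < q.2.2.det ∧ rel q.2.2 (f q.1 s) q.2.1 = 0}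
  have hB₁ : ∀ q, (B₁ q).Countable := by
    rintro ⟨b, b', g⟩
    by_cases hbb : b ≠ b' ∧ 0 < g.det
    · refine (countable_zeros_of_not_eventuallyEq (f := fun s => rel g (f b s) (f b' s)) hε
        ?_ ?_).mono (fun (s : ℂ) (hs : s ∈ B₁ (b, b', g)) => Set.mem_inter hs.1 hs.2.2.2)
      · exact ((hf b').mul (((hf b).const_mul _).add_const _)).sub
          (((hf b).const_mul _).add_const _)
      · intro hev
        have hgz := (hrel g hbb.2 _ (hH b 0 h0) _).1 hev.self_of_nhds
        obtain ⟨heq, hne⟩ := hpair b b' hbb.1 ⟨g, hbb.2, hgz⟩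
        rw [← heq] at hgz
        obtain ⟨g1, g2, g3⟩ := eq_scalar_of_moeb_eq_self (hH b 0 h0)
          (fun hS => hsig b _ hS (GRel.refl _)) hbb.2 hgz
        have hg11 : (g 1 1 : ℂ) ≠ 0 := by
          intro h
          have h' : g 1 1 = 0 := by exact_mod_cast h
          have := hbb.2
          rw [Matrix.det_fin_two, g1, h'] at this
          simp at this
        refine hne (hev.mono fun s hs => ?_)
        simp only [rel, g1, g2, g3, Rat.cast_zero, zero_mul, zero_add, add_zero] at hs
        refine mul_left_cancel₀ hg11 ?_
        linear_combination -hs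
    · refine Set.Countable.mono (s₂ := ∅) (fun s hs => hbb ⟨hs.2.1, hs.2.2.1⟩) Set.countable_empty
  have hB₂ : ∀ q, (B₂ q).Countable := by
    rintro ⟨b, c, g⟩
    by_cases hg : 0 < g.det
    · refine (countable_zeros_of_not_eventuallyEq (f := fun s => rel g (f b s) c) hε
        ?_ ?_).mono (fun (s : ℂ) (hs : s ∈ B₂ (b, c, g)) => Set.mem_inter hs.1 hs.2.2)
      · exact ((((hf b).const_mul _).add_const _).const_mul _).sub
          (((hf b).const_mul _).add_const _)
      · intro hev
        exact hsig b c c.2 ⟨g, hg, (hrel g hg _ (hH b 0 h0) _).1 hev.self_of_nhds⟩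
    · exact Set.Countable.mono (s₂ := ∅) (fun s hs => hg hs.2.1) Set.countable_empty
  have : Countable SigmaSet := countable_SigmaSet.to_subtype
  have hbad : ((⋃ q, B₁ q) ∪ ⋃ q, B₂ q).Countable :=
    (Set.countable_iUnion hB₁).union (Set.countable_iUnion hB₂)
  obtain ⟨s, hs, hsb⟩ := (hbad.dense_compl ℂ).exists_mem_open isOpen_ball ⟨0, h0⟩ 
  refine ⟨s, hsb, fun b b' h => ?_, fun b c hc h => ?_⟩
  · by_contra hbb
    obtain ⟨g, hg, hgs⟩ := h
    exact hs (Or.inl (Set.mem_iUnion.2 ⟨(b, b', g), hsb, hbb, hg, (hrel g hg _ (hH b s hsb) _).2 hgs⟩))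
  · obtain ⟨g, hg, hgs⟩ := h
    exact hs (Or.inr (Set.mem_iUnion.2 ⟨(b, ⟨c, hc⟩, g), hsb, hg,
      (hrel g hg _ (hH b s hsb) _).2 hgs⟩))

lemma analyticOrderAt_comp_pow_sub {h : ℂ → ℂ} (hh : AnalyticAt ℂ h 0) (hd : deriv h 0 ≠ 0)
    {n : ℕ} (hn : n ≠ 0) : analyticOrderAt (fun s => h (s ^ n) - h 0) 0 = n := by
  have h1 : AnalyticAt ℂ (fun u => h u - h 0) ((fun s : ℂ => s ^ n) 0) := by
    change AnalyticAt ℂ _ ((0 : ℂ) ^ n)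
    rw [zero_pow hn]
    exact hh.sub analyticAt_const
  have h2 := h1.analyticOrderAt_comp (g := fun s : ℂ => s ^ n) (by fun_prop)
  have h3 := hh.analyticOrderAt_sub_eq_one_of_deriv_ne_zero hd
  have h4 := analyticOrderAt_centeredMonomial (𝕜 := ℂ) (z₀ := 0) (n := n)
  simp only [zero_pow hn, sub_zero] at h2
  have h5 : (fun s : ℂ => s ^ n) = ((· - (0 : ℂ)) ^ n : ℂ → ℂ) := by ext; simp
  rw [h3, one_mul, h5, h4] at h2
  rw [← h2]
  congr 1
  ext s
  simp

lemma not_eventuallyEq_comp_pow {h : ℂ → ℂ} (hh : AnalyticAt ℂ h 0) (hd : deriv h 0 ≠ 0)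
    {n m : ℕ} (hn : n ≠ 0) (hm : m ≠ 0) (hnm : n ≠ m) :
    ¬ ∀ᶠ s in 𝓝 (0 : ℂ), h (s ^ n) = h (s ^ m) := fun hev => by
  have := analyticOrderAt_congr (f := fun s => h (s ^ n) - h 0) (g := fun s => h (s ^ m) - h 0)
    (hev.mono fun s hs => by simp [hs])
  rw [analyticOrderAt_comp_pow_sub hh hd hn, analyticOrderAt_comp_pow_sub hh hd hm] at this
  exact hnm (by exact_mod_cast this)

end

section

open Filter Topology Metric Matrix

lemma jet_congr {j : ℂ → ℂ} {κ κ' : Type*} {x : κ → ℂ} {y : κ' → ℂ} {a : κ} {b : κ'}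
    (h : x a = y b) (k : ℕ) : jet j x (k, a) = jet j y (k, b) := by
  cases k with
  | zero => exact h
  | succ k => exact congrArg _ h

section
variable {j : ℂ → ℂ} {κ : Type*} [Fintype κ] [DecidableEq κ] {w : κ → ℂ}

/-- A transcendence basis of the jet coordinates adapted to the points `Z` which are killed by all
tangent vectors and to a family of dual derivations. -/
lemma exists_adapted_basis (hw : ∀ i, w i ∈ HH) {Z S : Finset κ}
    (hZ : ∀ i ∈ Z, ∀ y ∈ jetTangent j w, y i = 0) {E : κ → ℂ → ℂ}
    (hE : ∀ l ∈ S, IsJDeriv j (E l) ∧ ∀ k ∈ S, E l (w k) = if k = l then 1 else 0) :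
    ∃ t U : Finset (Fin 4 × κ), (∀ p ∈ t, p.2 ∈ Z) ∧
      (∀ p, p.2 ∈ Z → jet j w (jetIdx p) ∈ acl ⊥ ((fun p => jet j w (jetIdx p)) '' ↑t)) ∧
      t.card + S.card + U.card ≤ trdegF ⊥ (fun p : Fin 4 × κ => jet j w (jetIdx p)) ∧
      ∀ p, jet j w (jetIdx p) ∈ acl ⊥ ((fun p => jet j w (jetIdx p)) ''
        ↑(t ∪ S.image (fun k => ((0 : Fin 4), k)) ∪ U)) := by
  set v : Fin 4 × κ → ℂ := fun p => jet j w (jetIdx p) with hv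
  obtain ⟨t, -, htZ, ht, htspan⟩ := exists_algebraicIndependent_between (K := ⊥) (v := v)
    (algebraicIndependent_empty_finset) (Finset.empty_subset (Finset.univ.filter fun p => p.2 ∈ Z))
  have htZ' : ∀ p ∈ t, p.2 ∈ Z := fun p hp => (Finset.mem_filter.1 (htZ hp)).2
  have key : ∀ S₁ : Finset κ, S₁ ⊆ S →
      AlgebraicIndependent (⊥ : Subfield ℂ)
        (fun k : (t ∪ S₁.image (fun k => ((0 : Fin 4), k)) : Finset _) => v k.1) ∧
      (t ∪ S₁.image (fun k => ((0 : Fin 4), k))).card = t.card + S₁.card := by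
    intro S₁
    induction S₁ using Finset.induction_on with
    | empty =>
      intro _
      rw [Finset.image_empty, Finset.union_empty]
      exact ⟨ht, by simp⟩
    | insert k S₁ hk ih =>
      intro hS
      obtain ⟨ih1, ih2⟩ := ih ((Finset.subset_insert _ _).trans hS)
      obtain ⟨hEk, hEd⟩ := hE k (hS (Finset.mem_insert_self _ _))
      have hmem : v (0, k) ∉ acl ⊥ (v '' ↑(t ∪ S₁.image (fun k => ((0 : Fin 4), k)))) := by
        intro hmem
        have h0 : E k (v (0, k)) = 0 := hEk.acl_le_ker (A := v '' _) (by
          rintro _ ⟨⟨a, i⟩, hp, rfl⟩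
          rcases Finset.mem_union.1 (Finset.mem_coe.1 hp) with hp | hp
          · have hz : E k (w i) = 0 := hZ i (htZ' _ hp) _ (hEk.mem_jetTangent hw)
            change E k (jet j w ((a : ℕ), i)) = 0
            cases (a : ℕ) with
            | zero => exact hz
            | succ m => exact (hEk.2.2 _ (hw i) m).trans (by rw [hz, mul_zero])
          · obtain ⟨l, hl, hli⟩ := Finset.mem_image.1 hp
            rw [← hli]
            have := hEd l (hS (Finset.mem_insert_of_mem hl))
            rw [if_neg (show l ≠ k from fun h => hk (h ▸ hl))] at this
            exact this) hmem
        have h1 := hEd k (hS (Finset.mem_insert_self _ _))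
        rw [if_pos rfl] at h1
        exact one_ne_zero (h1.symm.trans h0)
      rw [Finset.image_insert, Finset.union_insert]
      refine ⟨algebraicIndependent_insert ih1 hmem, ?_⟩
      rw [Finset.card_insert_of_notMem fun h => hmem (subset_acl _ _ ⟨_, h, rfl⟩), ih2,
        Finset.card_insert_of_notMem hk, add_assoc]
  obtain ⟨h1, h2⟩ := key S subset_rfl
  obtain ⟨u, hu, -, hui, huspan⟩ := exists_algebraicIndependent_between h1 (Finset.subset_univ _)
  refine ⟨t, u \ (t ∪ S.image (fun k => ((0 : Fin 4), k))), htZ', fun p hp => htspan p (by simpa),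
    ?_, fun p => ?_⟩
  · rw [← h2, add_comm, Finset.card_sdiff_add_card_eq_card hu]
    exact card_le_trdegF hui
  · rw [Finset.union_sdiff_of_subset hu]
    exact huspan p (Finset.mem_univ _)

/-- Sampling a jet curve at `N` generic points and applying `MSCD` to all samples at once. -/
lemma MSCD.card_le_of_curve (hM : MSCD j) (hw : ∀ i, w i ∈ HH)
    (hinj : ∀ a b, GRel (w a) (w b) → a = b) (hsig : ∀ a, ∀ c ∈ SigmaSet, ¬ GRel (w a) c)
    {Z S : Finset κ} {t U : Finset (Fin 4 × κ)} (htZ : ∀ p ∈ t, p.2 ∈ Z)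
    (ht : ∀ p, p.2 ∈ Z → jet j w (jetIdx p) ∈ acl ⊥ ((fun p => jet j w (jetIdx p)) '' ↑t))
    {ε : ℝ} (hε : 0 < ε) (hε1 : ε ≤ 1) {γ : ℂ → κ → ℂ} (hγ : DifferentiableOn ℂ γ (ball 0 ε))
    (hγ0 : γ 0 = w) (hH : ∀ s ∈ ball (0 : ℂ) ε, ∀ i, γ s i ∈ HH) {v : κ → ℂ}
    (hγ' : deriv γ 0 = v) (hv : ∀ i ∉ Z, v i ≠ 0)
    (hγZ : ∀ s ∈ ball (0 : ℂ) ε, ∀ i ∈ Z, γ s i = w i)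
    (hγS : ∀ s ∈ ball (0 : ℂ) ε, ∀ k ∈ S, γ s k = w k + s * v k)
    (hspan : ∀ s ∈ ball (0 : ℂ) ε, ∀ p, jet j (γ s) (jetIdx p) ∈ acl ⊥
      ((fun p => jet j (γ s) (jetIdx p)) '' ↑(t ∪ S.image (fun k => ((0 : Fin 4), k)) ∪ U)))
    (N : ℕ) :
    3 * (Z.card + Zᶜ.card * N) ≤ t.card + 2 * S.card + 1 + N * U.card := by
  have hpow : ∀ s ∈ ball (0 : ℂ) ε, ∀ n : ℕ, s ^ (n + 1) ∈ ball (0 : ℂ) ε := fun s hs n => by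
    rw [mem_ball_zero_iff] at hs ⊢
    rw [norm_pow]
    exact (pow_le_of_le_one (norm_nonneg s) (hs.le.trans hε1) n.succ_ne_zero).trans_lt hs
  have h0 : (0 : ℂ) ∈ ball (0 : ℂ) ε := mem_ball_self hε
  let β := {i // i ∈ Z} ⊕ ({i // i ∈ Zᶜ} × Fin N)
  let idx : β → κ := Sum.elim (fun i => i.1) fun q => q.1.1
  let f : β → ℂ → ℂ := Sum.elim (fun i _ => w i) fun q s => γ (s ^ ((q.2 : ℕ) + 1)) q.1
  have hfH : ∀ b, ∀ s ∈ ball (0 : ℂ) ε, f b s ∈ HH := by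
    rintro (i | q) s hs
    · exact hw i
    · exact hH _ (hpow s hs q.2) _
  have hf0 : ∀ b, f b 0 = w (idx b) := by
    rintro (i | q)
    · rfl
    · simp [f, idx, hγ0]
  have hγi : ∀ i, DifferentiableOn ℂ (fun s => γ s i) (ball 0 ε) := fun i =>
    differentiableOn_pi.1 hγ i
  have hfd : ∀ b, DifferentiableOn ℂ (f b) (ball 0 ε) := by
    rintro (i | q)
    · exact differentiableOn_const _
    · exact (hγi q.1).comp (by fun_prop) fun s hs => hpow s hs q.2
  obtain ⟨s, hs, hs1, hs2⟩ := exists_generic hε hfd hfH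
    (fun b c hc h => hsig (idx b) c hc (hf0 b ▸ h)) (by
      intro b b' hbb h
      rw [hf0, hf0] at h
      have hidx : idx b = idx b' := hinj _ _ h
      refine ⟨by rw [hf0, hf0, hidx], ?_⟩
      rcases b with i | ⟨i, ν⟩ <;> rcases b' with i' | ⟨i', ν'⟩
      · exact absurd (congrArg Sum.inl (Subtype.ext hidx)) hbb
      · exact absurd (show (i : κ) = i' from hidx) fun h => Finset.mem_compl.1 i'.2 (h ▸ i.2)
      · exact absurd (show (i : κ) = i' from hidx) fun h => Finset.mem_compl.1 i.2 (h ▸ i'.2)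
      · obtain rfl : i = i' := Subtype.ext hidx
        have hν : (ν : ℕ) + 1 ≠ (ν' : ℕ) + 1 := fun h => hbb (by
          rw [Fin.ext (Nat.succ_injective h)])
        refine not_eventuallyEq_comp_pow (h := fun s => γ s i)
          ((hγi i).analyticAt (isOpen_ball.mem_nhds h0)) ?_ (Nat.succ_ne_zero _)
          (Nat.succ_ne_zero _) hν
        have hd : HasDerivAt γ v 0 := by
          rw [← hγ']
          exact (hγ.differentiableAt (isOpen_ball.mem_nhds h0)).hasDerivAt
        rw [(hasDerivAt_pi.1 hd i).deriv]
        exact hv i (Finset.mem_compl.1 i.2))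
  let G : Finset ℂ := t.image (fun p => jet j w (jetIdx p)) ∪ S.image w ∪ S.image v ∪ {s} ∪
    Finset.univ.biUnion fun ν : Fin N => U.image fun p => jet j (γ (s ^ ((ν : ℕ) + 1))) (jetIdx p)
  have hGcard : G.card ≤ t.card + 2 * S.card + 1 + N * U.card := by
    have h1 : (Finset.univ.biUnion fun ν : Fin N =>
        U.image fun p => jet j (γ (s ^ ((ν : ℕ) + 1))) (jetIdx p)).card ≤ N * U.card := by
      refine Finset.card_biUnion_le.trans ((Finset.sum_le_card_nsmul _ _ U.card
        fun ν _ => Finset.card_image_le).trans_eq (by simp))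
    have h2 : (t.image (fun p => jet j w (jetIdx p))).card ≤ t.card := Finset.card_image_le
    have h3 : (S.image w).card ≤ S.card := Finset.card_image_le
    have h4 : (S.image v).card ≤ S.card := Finset.card_image_le
    have h5 := Finset.card_union_le (t.image (fun p => jet j w (jetIdx p))) (S.image w)
    have h6 := Finset.card_union_le (t.image (fun p => jet j w (jetIdx p)) ∪ S.image w) (S.image v)
    have h7 := Finset.card_union_le
      (t.image (fun p => jet j w (jetIdx p)) ∪ S.image w ∪ S.image v) {s}
    have h8 := Finset.card_union_le
      (t.image (fun p => jet j w (jetIdx p)) ∪ S.image w ∪ S.image v ∪ {s})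
      (Finset.univ.biUnion fun ν : Fin N =>
        U.image fun p => jet j (γ (s ^ ((ν : ℕ) + 1))) (jetIdx p))
    rw [Finset.card_singleton] at h7
    change (_ ∪ _ : Finset ℂ).card ≤ _
    omega
  have hGsub : (G : Set ℂ) ⊆ acl ⊥ (G : Set ℂ) := subset_acl _ _
  have hGt : (fun p => jet j w (jetIdx p)) '' ↑t ⊆ (G : Set ℂ) := by
    rintro _ ⟨p, hp, rfl⟩
    simp only [G, Finset.coe_union, Finset.coe_image]
    exact Or.inl (Or.inl (Or.inl (Or.inl ⟨p, hp, rfl⟩)))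
  have hGw : ∀ k ∈ S, w k ∈ G := fun k hk => by
    simp only [G, Finset.mem_union]
    exact Or.inl (Or.inl (Or.inl (Or.inr (Finset.mem_image_of_mem _ hk))))
  have hGv : ∀ k ∈ S, v k ∈ G := fun k hk => by
    simp only [G, Finset.mem_union]
    exact Or.inl (Or.inl (Or.inr (Finset.mem_image_of_mem _ hk)))
  have hGs : s ∈ G := by
    simp only [G, Finset.mem_union]
    exact Or.inl (Or.inr (Finset.mem_singleton_self s))
  have hGU : ∀ ν : Fin N, ∀ p ∈ U, jet j (γ (s ^ ((ν : ℕ) + 1))) (jetIdx p) ∈ G := fun ν p hp => by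
    simp only [G, Finset.mem_union]
    exact Or.inr (Finset.mem_biUnion.2 ⟨ν, Finset.mem_univ _, Finset.mem_image.2 ⟨p, hp, rfl⟩⟩)
  have hmain := hM.card_le (z := fun b => f b s) (fun b => hfH b s hs) hs1 hs2 (G := G) (by
    rintro ⟨a, i | ⟨i, ν⟩⟩
    · have : jet j (fun b => f b s) (jetIdx (a, Sum.inl i)) = jet j w (jetIdx (a, i.1)) :=
        jet_congr (x := fun b => f b s) (y := w) (a := Sum.inl i) rfl _
      rw [this]
      exact acl_mono _ hGt (ht _ i.2)
    · have : jet j (fun b => f b s) (jetIdx (a, Sum.inr (i, ν))) =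
          jet j (γ (s ^ ((ν : ℕ) + 1))) (jetIdx (a, i.1)) :=
        jet_congr (x := fun b => f b s) (y := γ (s ^ ((ν : ℕ) + 1))) (a := Sum.inr (i, ν)) (b := i.1)
          rfl _
      rw [this]
      have hsν := hpow s hs ν
      refine acl_le_acl bot_le ?_ (hspan _ hsν (a, i.1))
      rintro _ ⟨⟨b, l⟩, hp, rfl⟩
      rcases Finset.mem_union.1 (Finset.mem_coe.1 hp) with hp | hp
      · rcases Finset.mem_union.1 hp with hp | hp
        · have : jet j (γ (s ^ ((ν : ℕ) + 1))) (jetIdx (b, l)) = jet j w (jetIdx (b, l)) :=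
            jet_congr (hγZ _ hsν l (htZ _ hp)) _
          exact hGsub (this.symm ▸ hGt ⟨_, hp, rfl⟩ : jet j _ (jetIdx (b, l)) ∈ (G : Set ℂ))
        · obtain ⟨k, hk, hkl⟩ := Finset.mem_image.1 hp
          rw [← hkl]
          change γ (s ^ ((ν : ℕ) + 1)) k ∈ acl ⊥ (G : Set ℂ)
          rw [hγS _ hsν k hk]
          exact add_mem (hGsub (hGw k hk)) (mul_mem (pow_mem (hGsub hGs) _) (hGsub (hGv k hk)))
      · exact hGsub (hGU ν _ hp))
  refine le_trans (le_of_eq ?_) (hmain.trans hGcard)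
  simp only [β, Fintype.card_sum, Fintype.card_prod, Fintype.card_coe, Fintype.card_fin]

end

end

section

open Filter Topology Metric Matrix

/-- Under `MSCD`, the jets of `G`-independent non-special points have transcendence degree at least
three times the number of points plus the number of independent `j`-derivations. -/
theorem MSCD.card_add_le_trdegF {j : ℂ → ℂ} (hM : MSCD j) (hj : DifferentiableOn ℂ j HH)
    {κ : Type*} [Fintype κ] [DecidableEq κ] {w : κ → ℂ} (hw : ∀ i, w i ∈ HH)
    (hinj : ∀ a b, GRel (w a) (w b) → a = b) (hsig : ∀ a, ∀ c ∈ SigmaSet, ¬ GRel (w a) c)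
    {d : ℕ} {D : Fin d → ℂ → ℂ} (hD : ∀ i, IsJDeriv j (D i))
    (hli : LinearIndependent ℂ fun i k => D i (w k)) :
    3 * Fintype.card κ + d ≤ trdegF ⊥ (fun p : Fin 4 × κ => jet j w (jetIdx p)) := by
  classical
  obtain ⟨S₀, hS₀, hcurve⟩ := exists_jet_curve hj hw
  obtain ⟨S, hSS₀, hdS, E, hE⟩ := exists_dual_jDer hw hS₀ hD hli
  let Z : Finset κ := Finset.univ.filter fun i => ∀ y ∈ jetTangent j w, y i = 0
  have hZ : ∀ i, i ∈ Z ↔ ∀ y ∈ jetTangent j w, y i = 0 := fun i => by simp [Z]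
  obtain ⟨t, U, htZ, ht, hcard, hspan⟩ := exists_adapted_basis hw (fun i hi => (hZ i).1 hi) hE
  obtain ⟨v, hvT, hv⟩ := Module.Dual.exists_forall_mem_ne_zero_of_forall_exists (jetTangent j w)
    (fun i : {i // i ∉ Z} => (LinearMap.proj i.1 : (κ → ℂ) →ₗ[ℂ] ℂ)) (fun i => by
      have := i.2
      rw [hZ] at this
      push Not at this
      exact this)
  obtain ⟨ε, hε, γ, hγ, hγ0, hγ', hH, hγS, hγP⟩ := hcurve v hvT
  have hγZ : ∀ s ∈ ball (0 : ℂ) ε, ∀ i ∈ Z, γ s i = w i := fun s hs i hi => by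
    have := hγP (MvPolynomial.X (0, i)) (fun y hy => by
      have hgrad : jetGrad j w (MvPolynomial.X (0, i)) = Pi.single i 1 := by
        ext l
        rcases eq_or_ne i l with rfl | h
        · simp [jetGrad]
        · simp [jetGrad, h]
      rw [hgrad, single_dotProduct, (hZ i).1 hi y hy, mul_zero]) s hs
    rwa [jetEval_X, jetEval_X] at this
  have hspan' : ∀ p : Fin 4 × κ, jet j w (jetIdx p) ∈ acl ⊥ (jet j w ''
      (jetIdx '' ↑(t ∪ S.image (fun k => ((0 : Fin 4), k)) ∪ U))) := fun p => by
    rw [Set.image_image]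
    exact hspan p
  choose C hC0 hC using fun p => exists_specialisation (hspan' p)
  have hCev : ∀ᶠ s in 𝓝 (0 : ℂ), ∀ p, jetEval j (γ s) (C p) ≠ 0 := by
    refine eventually_all.2 fun p => ?_
    have hcont := (analyticAt_curve isOpen_ball hγ hj hH (C p) (mem_ball_self hε)).continuousAt
    refine hcont.eventually_ne ?_
    rw [hγ0]
    exact hC0 p
  obtain ⟨δ, hδ, hδC⟩ := Metric.eventually_nhds_iff_ball.1 hCev
  have hρ : 0 < min (min ε δ) 1 := lt_min (lt_min hε hδ) one_pos
  have hρε : ball (0 : ℂ) (min (min ε δ) 1) ⊆ ball 0 ε :=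
    ball_subset_ball ((min_le_left _ _).trans (min_le_left _ _))
  have hρδ : ball (0 : ℂ) (min (min ε δ) 1) ⊆ ball 0 δ :=
    ball_subset_ball ((min_le_left _ _).trans (min_le_right _ _))
  have hsample := hM.card_le_of_curve hw hinj hsig htZ ht hρ (min_le_right _ _) (hγ.mono hρε) hγ0
    (fun s hs => hH s (hρε hs)) hγ' (fun i hi => hv ⟨i, hi⟩) (fun s hs => hγZ s (hρε hs))
    (fun s hs k hk => hγS s (hρε hs) k (hSS₀ hk)) (U := U) (fun s hs p => by
      have := hC p (γ s) (fun P hP => (hγP P (fun y hy => hy P hP) s (hρε hs)).trans hP)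
        (hδC s (hρδ hs) p)
      rwa [Set.image_image] at this)
  have hU : 3 * Zᶜ.card ≤ U.card := by
    by_contra! hlt
    have h1 := hsample (t.card + 2 * S.card + 2)
    have h2 : (t.card + 2 * S.card + 2) * (U.card + 1) ≤
        (t.card + 2 * S.card + 2) * (3 * Zᶜ.card) := Nat.mul_le_mul_left _ hlt
    nlinarith
  have htc : 3 * Z.card ≤ t.card := by
    have := hM.card_le (z := fun i : {i // i ∈ Z} => w i) (fun i => hw i)
      (fun a b h => Subtype.ext (hinj _ _ h)) (fun a => hsig a)
      (G := t.image fun p => jet j w (jetIdx p)) (fun p => by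
        have h := ht (p.1, p.2.1) p.2.2
        rw [Finset.coe_image]
        rw [show jet j (fun i : {i // i ∈ Z} => w i) (jetIdx p) = jet j w (jetIdx (p.1, p.2.1)) from
          jet_congr (x := fun i : {i // i ∈ Z} => w i) (a := p.2) rfl _]
        exact h)
    rw [Fintype.card_coe] at this
    exact this.trans Finset.card_image_le
  have := Finset.card_add_card_compl Z
  omega

end

/-- Representatives for the `G`-orbits counted by `dimG`. -/
lemma exists_orbit_representatives {ι : Type*} [Fintype ι] {z : ι → ℂ} (hz : ∀ i, z i ∈ HH)
    (C : Set ℂ) :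
    ∃ I : Finset ι, I.card = dimG z C ∧ (∀ a ∈ I, ∀ b ∈ I, GRel (z a) (z b) → a = b) ∧
      (∀ a ∈ I, ∀ c ∈ C, ¬ GRel (z a) c) ∧
      ∀ i, (∃ c ∈ C, GRel (z i) c) ∨ ∃ a ∈ I, GRel (z a) (z i) := by
  classical
  set O : Set (Set ℂ) := {S | ∃ i : ι, S = Gorb (z i) ∧ ∀ c ∈ C, ¬ GRel (z i) c} with hO
  have hfin : O.Finite := (Set.finite_range fun i => Gorb (z i)).subset
    fun S ⟨i, hi, _⟩ => ⟨i, hi.symm⟩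
  have := hfin.fintype
  choose f hf hfC using fun S : O => S.2
  have hinj : Function.Injective f := fun S S' h => Subtype.ext (by rw [hf S, hf S', h])
  refine ⟨Finset.univ.image f, ?_, ?_, ?_, fun i => ?_⟩
  · rw [Finset.card_image_of_injective _ hinj, Finset.card_univ, dimG, ← hO,
      ← Nat.card_coe_set_eq, Nat.card_eq_fintype_card]
  · simp only [Finset.mem_image, Finset.mem_univ, true_and]
    rintro _ ⟨S, rfl⟩ _ ⟨S', rfl⟩ h
    have := h.gorb_eq (hz _)
    rw [← hf, ← hf] at this
    rw [Subtype.ext this]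
  · simp only [Finset.mem_image, Finset.mem_univ, true_and]
    rintro _ ⟨S, rfl⟩
    exact hfC S
  · by_cases h : ∃ c ∈ C, GRel (z i) c
    · exact Or.inl h
    · push Not at h
      let S : O := ⟨Gorb (z i), i, rfl, h⟩
      exact Or.inr ⟨f S, Finset.mem_image_of_mem _ (Finset.mem_univ _),
        GRel.of_gorb_eq (hf S).symm⟩

lemma exists_jDeriv_linearIndependent {j : ℂ → ℂ} {m n : ℕ} {t : Fin m → ℂ} {z : Fin n → ℂ}
    {κ : Type*} {w : κ → ℂ}
    (ht : ∀ D, IsJDeriv j D → (∀ k, D (w k) = 0) → ∀ i, D (t i) = 0)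
    (hz : ∀ D, IsJDeriv j D → (∀ k, D (w k) = 0) → ∀ i, D (z i) = 0) :
    ∃ D : Fin (dimj j (Set.range t) ∅ + dimj j (Set.range z) (Set.range t)) → ℂ → ℂ,
      (∀ i, IsJDeriv j (D i)) ∧ LinearIndependent ℂ fun i k => D i (w k) := by
  obtain ⟨a, A, ha, hA, hAa⟩ := dimjGE_dimj j (Set.range t) ∅
  obtain ⟨b, B, hb, hB, hBb⟩ := dimjGE_dimj j (Set.range z) (Set.range t)
  have hAB : ∀ q, IsJDeriv j (Sum.elim A B q) := by
    rintro (i | i)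
    · exact (hA i).1
    · exact (hB i).1
  refine ⟨fun i => Sum.elim A B (finSumFinEquiv.symm i), fun i => hAB _, ?_⟩
  refine (linearIndependent_equiv finSumFinEquiv.symm
    (f := fun q k => Sum.elim A B q (w k))).2 ?_
  rw [Fintype.linearIndependent_iff]
  intro g hg
  let Δ : ℂ → ℂ := ∑ q, g q • Sum.elim A B q
  have hΔ : IsJDeriv j Δ := (Submodule.sum_mem (jDer j) fun q _ =>
    Submodule.smul_mem _ _ (hAB q) : Δ ∈ jDer j)
  have hΔapp : ∀ x, Δ x = ∑ i, g (Sum.inl i) * A i x + ∑ i, g (Sum.inr i) * B i x := fun x => by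
    simp [Δ, Fintype.sum_sum_type]
  have hΔw : ∀ k, Δ (w k) = 0 := fun k => by
    have := congrFun hg k
    simpa [Δ] using this
  have hBa : ∀ i k, B i (a k) = 0 := fun i k => ha k (B i) (hB i).1 (hB i).2
  have hgl : ∀ k, g (Sum.inl k) = 0 := fun k => by
    have h := ha k Δ hΔ (by rintro _ ⟨i, rfl⟩; exact ht Δ hΔ hΔw i)
    rw [hΔapp] at h
    simpa [hBa, hAa] using h
  rintro (k | k)
  · exact hgl k
  · have h := hb k Δ hΔ (by rintro _ ⟨i, rfl⟩; exact hz Δ hΔ hΔw i)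
    rw [hΔapp] at h
    simpa [hgl, hBb] using h

lemma trdegF_le_of_forall_exists {K : Subfield ℂ} {ι ι' : Type*} [Fintype ι'] {v : ι → ℂ}
    {v' : ι' → ℂ} (X : Finset ℂ) (h : ∀ i, v i ∈ acl K (Set.range v' ∪ X)) :
    trdegF K v ≤ trdegF K v' + X.card := by
  classical
  obtain ⟨T, hT, hTs⟩ := exists_finset_card_le_trdegF (K := K) (v := v')
  have hsub : Set.range v' ∪ ↑X ⊆ (acl K ↑(T.image v' ∪ X) : Set ℂ) := by
    rw [Finset.coe_union, Finset.coe_image]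
    refine Set.union_subset ?_ (Set.subset_union_right.trans (subset_acl _ _))
    rintro _ ⟨i, rfl⟩
    exact acl_mono K Set.subset_union_left (hTs i)
  refine (trdegF_le fun i => acl_le_acl (field_le_acl _ _) hsub (h i)).trans
    ((Finset.card_union_le _ _).trans ?_)
  have := Finset.card_image_le (s := T) (f := v')
  omega

/-- Assuming MSCD: if `t ∈ ℍ^m` is a convenient tuple for `j` and
`F = ℚ(t, J(t))`, then for all `z ∈ ℍⁿ`,
`tr.deg_F F(z, J(z)) ≥ 3 dim_G(z | Σ ∪ t) + dim^j(z|t)` and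
`tr.deg_F F(z, j(z)) ≥ dim_G(z | Σ ∪ t) + dim^j(z|t)`. -/
theorem trdeg_over_convenient_field_of_MSCD
    (j : ℂ → ℂ) (hj : IsModularJ j) (hMSCD : MSCD j)
    (m : ℕ) (t : Fin m → ℂ) (ht : ConvenientTuple j t)
    (F : Subfield ℂ)
    (hF : F = Subfield.closure (Set.range t ∪ Set.range (j ∘ t) ∪
      Set.range (deriv j ∘ t) ∪ Set.range (deriv (deriv j) ∘ t)))
    (n : ℕ) (z : Fin n → ℂ) (hz : ∀ i, z i ∈ HH) :
    3 * dimG z (SigmaSet ∪ Set.range t) + dimj j (Set.range z) (Set.range t)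
      ≤ trdegF F (fun p : Fin 4 × Fin n =>
          ![z, j ∘ z, deriv j ∘ z, deriv (deriv j) ∘ z] p.1 p.2) ∧
    dimG z (SigmaSet ∪ Set.range t) + dimj j (Set.range z) (Set.range t)
      ≤ trdegF F (Sum.elim z (j ∘ z)) := by
  classical
  obtain ⟨htH, htconv⟩ := ht
  obtain ⟨J, hJcard, hJinj, hJsig, hJrep⟩ := exists_orbit_representatives htH SigmaSet
  obtain ⟨I, hIcard, hIinj, hIsig, hIrep⟩ := exists_orbit_representatives hz (SigmaSet ∪ Set.range t)
  let w : {a // a ∈ J} ⊕ {a // a ∈ I} → ℂ := Sum.elim (fun a => t a) fun a => z a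
  have hw : ∀ k, w k ∈ HH := by
    rintro (k | k)
    · exact htH k
    · exact hz k
  have hwinj : ∀ a b, GRel (w a) (w b) → a = b := by
    rintro (a | a) (b | b) h
    · exact congrArg Sum.inl (Subtype.ext (hJinj a a.2 b b.2 h))
    · exact absurd (h.symm (htH a)) (hIsig b b.2 _ (Or.inr ⟨a, rfl⟩))
    · exact absurd h (hIsig a a.2 _ (Or.inr ⟨b, rfl⟩))
    · exact congrArg Sum.inr (Subtype.ext (hIinj a a.2 b b.2 h))
  have hwsig : ∀ a, ∀ c ∈ SigmaSet, ¬ GRel (w a) c := by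
    rintro (a | a) c hc
    · exact hJsig a a.2 c hc
    · exact hIsig a a.2 c (Or.inl hc)
  have hDt : ∀ D, IsJDeriv j D → (∀ k, D (w k) = 0) → ∀ i, D (t i) = 0 := fun D hD hDw i => by
    rcases hJrep i with ⟨c, hc, h⟩ | ⟨a, ha, h⟩
    · exact hD.eq_zero_of_GRel_SigmaSet (htH i) hc h
    · exact hD.eq_zero_of_GRel h (hDw (Sum.inl ⟨a, ha⟩))
  have hDz : ∀ D, IsJDeriv j D → (∀ k, D (w k) = 0) → ∀ i, D (z i) = 0 := fun D hD hDw i => by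
    rcases hIrep i with ⟨c, hc | ⟨l, rfl⟩, h⟩ | ⟨a, ha, h⟩
    · exact hD.eq_zero_of_GRel_SigmaSet (hz i) hc h
    · exact hD.eq_zero_of_GRel (h.symm (hz i)) (hDt D hD hDw l)
    · exact hD.eq_zero_of_GRel h (hDw (Sum.inr ⟨a, ha⟩))
  obtain ⟨D, hD, hDli⟩ := exists_jDeriv_linearIndependent hDt hDz
  have hmain := hMSCD.card_add_le_trdegF hj.holo hw hwinj hwsig hD hDli
  rw [Fintype.card_sum, Fintype.card_coe, Fintype.card_coe, hJcard, hIcard] at hmain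
  simp only [← jet_jetIdx] at htconv ⊢
  let z' : {a // a ∈ I} → ℂ := fun a => z a
  have hsum : trdegF ⊥ (fun p => jet j w (jetIdx p)) ≤
      trdegF ⊥ (fun p : Fin 4 × Fin m => jet j t (jetIdx p)) +
        trdegF F (fun p : Fin 4 × {a // a ∈ I} => jet j z' (jetIdx p)) := by
    obtain ⟨T, hT, hTs⟩ := exists_finset_card_le_trdegF (K := F)
      (v := fun p : Fin 4 × {a // a ∈ I} => jet j z' (jetIdx p))
    refine (trdegF_le_of_forall_exists (T.image fun p => jet j z' (jetIdx p)) ?_).trans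
      (Nat.add_le_add_left (Finset.card_image_le.trans hT) _)
    set A : Set ℂ := Set.range (fun p : Fin 4 × Fin m => jet j t (jetIdx p)) ∪
      ↑(T.image fun p => jet j z' (jetIdx p)) with hA
    have htA : ∀ p : Fin 4 × Fin m, jet j t (jetIdx p) ∈ acl ⊥ A := fun p =>
      subset_acl _ _ (Or.inl ⟨p, rfl⟩)
    have hFA : F ≤ acl ⊥ A := by
      rw [hF, Subfield.closure_le]
      rintro _ (((⟨i, rfl⟩ | ⟨i, rfl⟩) | ⟨i, rfl⟩) | ⟨i, rfl⟩)
      exacts [htA (0, i), htA (1, i), htA (2, i), htA (3, i)]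
    rintro ⟨k, a | a⟩
    · have h1 : jet j w (jetIdx (k, Sum.inl a)) = jet j t (jetIdx (k, a.1)) :=
        jet_congr (x := w) (y := t) (a := Sum.inl a) (b := a.1) rfl _
      rw [h1]
      exact htA (k, a)
    · have h1 : jet j w (jetIdx (k, Sum.inr a)) = jet j z' (jetIdx (k, a)) :=
        jet_congr (x := w) (y := z') (a := Sum.inr a) rfl _
      rw [h1]
      refine acl_le_acl hFA (Set.Subset.trans ?_ (subset_acl _ _)) (hTs (k, a))
      rw [hA, Finset.coe_image]
      exact Set.subset_union_right
  have hz' : 3 * dimG z (SigmaSet ∪ Set.range t) + dimj j (Set.range z) (Set.range t) ≤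
      trdegF F (fun p : Fin 4 × {a // a ∈ I} => jet j z' (jetIdx p)) := by omega
  refine ⟨hz'.trans ?_, ?_⟩
  · refine (trdegF_le_of_forall_exists ∅ fun p => ?_).trans_eq (by rw [Finset.card_empty, add_zero])
    exact subset_acl _ _ (Or.inl ⟨(p.1, p.2.1),
      jet_congr (x := z) (y := z') (a := p.2.1) (b := p.2) rfl _⟩)
  · have h := trdegF_le_of_forall_exists (K := F) (v := fun p : Fin 4 × {a // a ∈ I} =>
      jet j z' (jetIdx p)) (v' := Sum.elim z (j ∘ z))
      (I.image (deriv j ∘ z) ∪ I.image (deriv (deriv j) ∘ z)) (fun p => subset_acl _ _ (by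
        obtain ⟨k, a⟩ := p
        rw [jet_jetIdx, Finset.coe_union, Finset.coe_image, Finset.coe_image]
        fin_cases k
        · exact Or.inl ⟨Sum.inl a, rfl⟩
        · exact Or.inl ⟨Sum.inr a, rfl⟩
        · exact Or.inr (Or.inl ⟨a, a.2, rfl⟩)
        · exact Or.inr (Or.inr ⟨a, a.2, rfl⟩)))
    have h1 := Finset.card_union_le (I.image (deriv j ∘ z)) (I.image (deriv (deriv j) ∘ z))
    have h2 := Finset.card_image_le (s := I) (f := deriv j ∘ z)
    have h3 := Finset.card_image_le (s := I) (f := deriv (deriv j) ∘ z)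
    omega

end ModularJPaper
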